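/- arXiv:2012.13752 — 9 statements merged into one kernel-verified Lean document; each statement's English description precedes it below -/
import Mathlib

section
/- Let P be a monotone order separable partially ordered set. If a net (x_γ)_{γ∈Γ} in P O₂-converges to x ∈ P, then it O₁-converges to x. -/
universe u

/-- A net `x : Γ → P` O₁-converges to `a`: there are a monotone increasing net `y` with
least upper bound of its range `a` and a monotone decreasing net `z` with greatest lower
bound of its range `a`, with eventually `y γ ≤ x γ ≤ z γ`. -/
def O1Converges {P : Type*} [PartialOrder P] {Γ : Type*} [Preorder Γ]
    (x : Γ → P) (a : P) : Prop :=
  ∃ y z : Γ → P, Monotone y ∧ Antitone z ∧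
    IsLUB (Set.range y) a ∧ IsGLB (Set.range z) a ∧
    ∃ γ₀, ∀ γ, γ₀ ≤ γ → y γ ≤ x γ ∧ x γ ≤ z γ

/-- A net `x : Γ → P` O₂-converges to `a`: there are an upward-directed set `M` with
`IsLUB M a` and a downward-directed set `N` with `IsGLB N a` such that for every
`(m, n) ∈ M × N`, eventually `m ≤ x γ ≤ n`. -/
def O2Converges {P : Type*} [PartialOrder P] {Γ : Type*} [Preorder Γ]
    (x : Γ → P) (a : P) : Prop :=
  ∃ M N : Set P, M.Nonempty ∧ DirectedOn (· ≤ ·) M ∧ N.Nonempty ∧ DirectedOn (· ≥ ·) N ∧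
    IsLUB M a ∧ IsGLB N a ∧
    ∀ m ∈ M, ∀ n ∈ N, ∃ γ₀, ∀ γ, γ₀ ≤ γ → m ≤ x γ ∧ x γ ≤ n

/-- A net `x : Γ → P` O₃-converges to `a`: there are sets `M`, `N` with `IsLUB M a` and
`IsGLB N a` such that for every `(m, n) ∈ M × N`, eventually `m ≤ x γ ≤ n`. -/
def O3Converges {P : Type*} [PartialOrder P] {Γ : Type*} [Preorder Γ]
    (x : Γ → P) (a : P) : Prop :=
  ∃ M N : Set P, IsLUB M a ∧ IsGLB N a ∧
    ∀ m ∈ M, ∀ n ∈ N, ∃ γ₀, ∀ γ, γ₀ ≤ γ → m ≤ x γ ∧ x γ ≤ n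

/-- A poset is monotone order separable if every (nonempty) upward-directed subset with a
supremum contains a sequence with the same supremum, and dually for downward-directed
subsets with an infimum. -/
def MonotoneOrderSeparable (P : Type*) [PartialOrder P] : Prop :=
  (∀ (M : Set P) (a : P), M.Nonempty → DirectedOn (· ≤ ·) M → IsLUB M a →
      ∃ s : ℕ → P, (∀ n, s n ∈ M) ∧ IsLUB (Set.range s) a) ∧
  (∀ (N : Set P) (a : P), N.Nonempty → DirectedOn (· ≥ ·) N → IsGLB N a →
      ∃ s : ℕ → P, (∀ n, s n ∈ N) ∧ IsGLB (Set.range s) a)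

/-- Replace a sequence in a directed set by a monotone one with the same supremum. -/
theorem aux_monotone_seq {P : Type*} [PartialOrder P] (M : Set P) (a : P)
    (hd : DirectedOn (· ≤ ·) M) (ha : IsLUB M a) (s : ℕ → P) (hs : ∀ n, s n ∈ M)
    (hsa : IsLUB (Set.range s) a) :
    ∃ m : ℕ → P, Monotone m ∧ (∀ n, m n ∈ M) ∧ IsLUB (Set.range m) a := by
  have hd' : ∀ p q : M, ∃ r : M, p ≤ r ∧ q ≤ r := by
    rintro ⟨p, hp⟩ ⟨q, hq⟩
    obtain ⟨r, hr, h1, h2⟩ := hd p hp q hq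
    exact ⟨⟨r, hr⟩, h1, h2⟩
  choose u hu1 hu2 using hd'
  let m : ℕ → M := fun n => Nat.rec ⟨s 0, hs 0⟩ (fun k p => u p ⟨s (k + 1), hs (k + 1)⟩) n
  have hsm : ∀ n, s n ≤ (m n).1 := by
    intro n
    cases n with
    | zero => exact le_refl _
    | succ k => exact hu2 (m k) ⟨s (k + 1), hs (k + 1)⟩
  refine ⟨fun n => (m n).1, monotone_nat_of_le_succ fun n => hu1 (m n) ⟨s (n + 1), hs (n + 1)⟩,
    fun n => (m n).2, ?_, ?_⟩
  · rintro _ ⟨n, rfl⟩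
    exact ha.1 (m n).2
  · intro b hb
    apply hsa.2
    rintro _ ⟨n, rfl⟩
    exact (hsm n).trans (hb ⟨n, rfl⟩)

/-- Spread a monotone sequence along a net using a sequence of indices. -/
theorem aux_spread {P : Type*} [PartialOrder P] {Γ : Type*} [Preorder Γ] (a : P)
    (m : ℕ → P) (hm : Monotone m) (ha : IsLUB (Set.range m) a) (g : ℕ → Γ) :
    ∃ y : Γ → P, Monotone y ∧ IsLUB (Set.range y) a ∧
      ∀ γ, g 0 ≤ γ → (∃ k, g k ≤ γ ∧ y γ = m k) ∨ (¬ BddAbove {k | g k ≤ γ} ∧ y γ = a) := by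
  classical
  have hma : ∀ k, m k ≤ a := fun k => ha.1 ⟨k, rfl⟩
  let y : Γ → P := fun γ => if BddAbove {k | g k ≤ γ} then m (sSup {k | g k ≤ γ}) else a
  have hya : ∀ γ, y γ ≤ a := by
    intro γ
    simp only [y]
    split_ifs
    · exact hma _
    · exact le_refl _
  refine ⟨y, ?_, ⟨?_, ?_⟩, ?_⟩
  · intro γ δ h
    have hsub : {k | g k ≤ γ} ⊆ {k | g k ≤ δ} := fun k hk => le_trans hk h
    by_cases hb : BddAbove {k | g k ≤ δ}
    · have hb' := hb.mono hsub
      simp only [y, if_pos hb, if_pos hb']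
      apply hm
      rcases Set.eq_empty_or_nonempty {k | g k ≤ γ} with he | hne
      · rw [he]; simp
      · exact csSup_le_csSup hb hne hsub
    · have : y δ = a := if_neg hb
      rw [this]
      exact hya γ
  · rintro _ ⟨γ, rfl⟩
    exact hya γ
  · intro b hb
    apply ha.2
    rintro _ ⟨k, rfl⟩
    refine le_trans ?_ (hb ⟨g k, rfl⟩)
    simp only [y]
    split_ifs with h
    · exact hm (le_csSup h (le_refl (g k)))
    · exact hma k
  · intro γ h0
    by_cases hb : BddAbove {k | g k ≤ γ}
    · exact Or.inl ⟨_, Nat.sSup_mem ⟨0, h0⟩ hb, if_pos hb⟩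
    · exact Or.inr ⟨hb, if_neg hb⟩

/-- In a monotone order separable poset, O₂-convergence implies O₁-convergence. -/
theorem o2_implies_o1_of_monotoneOrderSeparable {P : Type*} [PartialOrder P]
    (hP : MonotoneOrderSeparable P) {Γ : Type*} [Preorder Γ] [IsDirected Γ (· ≤ ·)]
    [Nonempty Γ] (x : Γ → P) (a : P) (h : O2Converges x a) : O1Converges x a := by
  obtain ⟨M, N, hM, hMd, hN, hNd, hMa, hNa, hx⟩ := h
  obtain ⟨s, hs, hsa⟩ := hP.1 M a hM hMd hMa
  obtain ⟨t, ht, hta⟩ := hP.2 N a hN hNd hNa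
  obtain ⟨m, hm, hmM, hma⟩ := aux_monotone_seq M a hMd hMa s hs hsa
  obtain ⟨n, hn, hnN, hna⟩ := aux_monotone_seq (P := Pᵒᵈ) N a hNd hNa t ht hta
  have hx' : ∀ k, ∃ γ₀, ∀ γ, γ₀ ≤ γ → m k ≤ x γ ∧ x γ ≤ n k :=
    fun k => hx _ (hmM k) _ (hnN k)
  choose g hg using hx'
  obtain ⟨y, hy, hya, hyx⟩ := aux_spread a m hm hma g
  obtain ⟨z, hz, hza, hzx⟩ := aux_spread (P := Pᵒᵈ) a n hn hna g
  have key1 : ∀ γ, ¬ BddAbove {k | g k ≤ γ} → a ≤ x γ := by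
    intro γ hb
    apply hma.2
    rintro _ ⟨k, rfl⟩
    obtain ⟨j, hj, hkj⟩ := not_bddAbove_iff.1 hb k
    exact (hm hkj.le).trans (hg j γ hj).1
  have key2 : ∀ γ, ¬ BddAbove {k | g k ≤ γ} → x γ ≤ a := by
    intro γ hb
    apply hna.2
    rintro _ ⟨k, rfl⟩
    obtain ⟨j, hj, hkj⟩ := not_bddAbove_iff.1 hb k
    exact le_trans (α := P) (hg j γ hj).2 (hn hkj.le)
  refine ⟨y, z, hy, fun γ δ h => hz h, hya, hza, g 0, fun γ h0 => ⟨?_, ?_⟩⟩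
  · rcases hyx γ h0 with ⟨k, hk, e⟩ | ⟨hb, e⟩
    · exact e.le.trans (hg k γ hk).1
    · exact e.le.trans (key1 γ hb)
  · rcases hzx γ h0 with ⟨k, hk, e⟩ | ⟨hb, e⟩
    · exact le_of_le_of_eq (α := P) (hg k γ hk).2 e.symm
    · exact le_of_le_of_eq (α := P) (key2 γ hb) e.symm
end

section
/- Let P be a partially ordered set and i ∈ {1, 2, 3}. The Oᵢ-closed subsets of P are the closed sets of a topology on P; that is: ∅ and P are Oᵢ-closed, the intersection of an arbitrary family of Oᵢ-closed sets is Oᵢ-closed, and the union of two Oᵢ-closed sets is Oᵢ-closed. -/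
universe u

/-- `X` is O₁-closed: no net in `X` O₁-converges to a point outside `X`. -/
def O1Closed {P : Type u} [PartialOrder P] (X : Set P) : Prop :=
  ∀ (Γ : Type u) [Preorder Γ] [IsDirected Γ (· ≤ ·)] [Nonempty Γ] (x : Γ → P),
    (∀ γ, x γ ∈ X) → ∀ a : P, O1Converges x a → a ∈ X

/-- `X` is O₂-closed: no net in `X` O₂-converges to a point outside `X`. -/
def O2Closed {P : Type u} [PartialOrder P] (X : Set P) : Prop :=
  ∀ (Γ : Type u) [Preorder Γ] [IsDirected Γ (· ≤ ·)] [Nonempty Γ] (x : Γ → P),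
    (∀ γ, x γ ∈ X) → ∀ a : P, O2Converges x a → a ∈ X

/-- `X` is O₃-closed: no net in `X` O₃-converges to a point outside `X`. -/
def O3Closed {P : Type u} [PartialOrder P] (X : Set P) : Prop :=
  ∀ (Γ : Type u) [Preorder Γ] [IsDirected Γ (· ≤ ·)] [Nonempty Γ] (x : Γ → P),
    (∀ γ, x γ ∈ X) → ∀ a : P, O3Converges x a → a ∈ X

/-- If a notion of convergence passes to cofinal subnets, its closed sets form a topology. -/
theorem closed_aux {P : Type u}
    (Conv : ∀ (Γ : Type u) [Preorder Γ], (Γ → P) → P → Prop)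
    (hsub : ∀ (Γ : Type u) [Preorder Γ] [IsDirected Γ (· ≤ ·)] (A : Set Γ),
      (∀ γ, ∃ δ ∈ A, γ ≤ δ) → ∀ (x : Γ → P) (a : P), Conv Γ x a →
        Conv A (fun γ : A => x γ) a)
    (C : Set P → Prop)
    (hC : ∀ X, C X ↔ ∀ (Γ : Type u) [Preorder Γ] [IsDirected Γ (· ≤ ·)] [Nonempty Γ]
      (x : Γ → P), (∀ γ, x γ ∈ X) → ∀ a : P, Conv Γ x a → a ∈ X) :
    C (∅ : Set P) ∧ C (Set.univ : Set P) ∧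
      (∀ 𝒮 : Set (Set P), (∀ s ∈ 𝒮, C s) → C (⋂₀ 𝒮)) ∧
      (∀ s t : Set P, C s → C t → C (s ∪ t)) := by
  refine ⟨?_, ?_, ?_, ?_⟩
  · rw [hC]
    intro Γ _ _ hne x hx
    exact (hx hne.some).elim
  · rw [hC]
    intros
    trivial
  · intro S hS
    rw [hC]
    intro Γ _ _ _ x hx a ha s hs
    exact (hC s).1 (hS s hs) Γ x (fun γ => hx γ s hs) a ha
  · have key : ∀ s : Set P, C s → ∀ (Γ : Type u) [Preorder Γ] [IsDirected Γ (· ≤ ·)]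
        [Nonempty Γ] (x : Γ → P) (a : P), Conv Γ x a →
        (∀ γ, ∃ δ ∈ {δ | x δ ∈ s}, γ ≤ δ) → a ∈ s := by
      intro s hs Γ _ _ hne x a ha hcof
      have : Nonempty {δ | x δ ∈ s} := by
        obtain ⟨δ, hδ, -⟩ := hcof hne.some
        exact ⟨⟨δ, hδ⟩⟩
      have : IsDirected {δ | x δ ∈ s} (· ≤ ·) := ⟨by
        intro p q
        obtain ⟨r, hpr, hqr⟩ := exists_ge_ge (p : Γ) (q : Γ)
        obtain ⟨δ, hδ, hr⟩ := hcof r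
        exact ⟨⟨δ, hδ⟩, Subtype.coe_le_coe.1 (le_trans hpr hr), Subtype.coe_le_coe.1 (le_trans hqr hr)⟩⟩
      exact (hC s).1 hs {δ | x δ ∈ s} (fun γ => x γ) (fun γ => γ.2) a (hsub Γ _ hcof x a ha)
    intro s t hs ht
    rw [hC]
    intro Γ _ _ _ x hx a ha
    by_cases h : ∀ γ, ∃ δ ∈ {δ | x δ ∈ s}, γ ≤ δ
    · exact Or.inl (key s hs Γ x a ha h)
    · right
      push Not at h
      obtain ⟨γ₀, h₀⟩ := h
      refine key t ht Γ x a ha (fun γ => ?_)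
      obtain ⟨r, h1, h2⟩ := exists_ge_ge γ₀ γ
      exact ⟨r, (hx r).resolve_left (fun hr => h₀ r hr h1), h2⟩

theorem eventually_aux {Γ : Type*} [Preorder Γ] {A : Set Γ} (hA : ∀ γ, ∃ δ ∈ A, γ ≤ δ)
    {p : Γ → Prop} (h : ∃ γ₀, ∀ γ, γ₀ ≤ γ → p γ) :
    ∃ γ₀ : A, ∀ γ : A, γ₀ ≤ γ → p γ := by
  obtain ⟨γ₀, h⟩ := h
  obtain ⟨δ, hδ, hle⟩ := hA γ₀
  exact ⟨⟨δ, hδ⟩, fun γ hγ => h γ (le_trans hle hγ)⟩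

theorem o1_sub {P : Type*} [PartialOrder P] {Γ : Type*} [Preorder Γ] {A : Set Γ}
    (hA : ∀ γ, ∃ δ ∈ A, γ ≤ δ) (x : Γ → P) (a : P) (h : O1Converges x a) :
    O1Converges (fun γ : A => x γ) a := by
  obtain ⟨y, z, hy, hz, hya, hza, hev⟩ := h
  refine ⟨fun γ => y γ, fun γ => z γ, fun _ _ h => hy h, fun _ _ h => hz h,
    ⟨?_, ?_⟩, ⟨?_, ?_⟩, eventually_aux hA hev⟩
  · rintro _ ⟨γ, rfl⟩
    exact hya.1 ⟨_, rfl⟩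
  · intro b hb
    refine hya.2 ?_
    rintro _ ⟨γ, rfl⟩
    obtain ⟨δ, hδ, hle⟩ := hA γ
    exact (hy hle).trans (hb ⟨⟨δ, hδ⟩, rfl⟩)
  · rintro _ ⟨γ, rfl⟩
    exact hza.1 ⟨_, rfl⟩
  · intro b hb
    refine hza.2 ?_
    rintro _ ⟨γ, rfl⟩
    obtain ⟨δ, hδ, hle⟩ := hA γ
    exact le_trans (hb ⟨⟨δ, hδ⟩, rfl⟩) (hz hle)

/-- For each `i ∈ {1, 2, 3}`, the Oᵢ-closed subsets of a poset are the closed sets of a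
topology: `∅` and the whole space are Oᵢ-closed, arbitrary intersections of Oᵢ-closed sets
are Oᵢ-closed, and the union of two Oᵢ-closed sets is Oᵢ-closed. -/
theorem oiClosed_forms_topology {P : Type u} [PartialOrder P]
    (C : Set P → Prop) (hC : C = O1Closed ∨ C = O2Closed ∨ C = O3Closed) :
    C (∅ : Set P) ∧ C (Set.univ : Set P) ∧
      (∀ 𝒮 : Set (Set P), (∀ s ∈ 𝒮, C s) → C (⋂₀ 𝒮)) ∧
      (∀ s t : Set P, C s → C t → C (s ∪ t)) := by
  rcases hC with rfl | rfl | rfl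
  · exact closed_aux (fun Γ _ x a => O1Converges x a)
      (fun Γ _ _ A hA x a h => o1_sub hA x a h) _ (fun _ => Iff.rfl)
  · refine closed_aux (fun Γ _ x a => O2Converges x a) ?_ _ (fun _ => Iff.rfl)
    rintro Γ _ _ A hA x a ⟨M, N, h1, h2, h3, h4, h5, h6, h⟩
    exact ⟨M, N, h1, h2, h3, h4, h5, h6, fun m hm n hn => eventually_aux hA (h m hm n hn)⟩
  · refine closed_aux (fun Γ _ x a => O3Converges x a) ?_ _ (fun _ => Iff.rfl)
    rintro Γ _ _ A hA x a ⟨M, N, h5, h6, h⟩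
    exact ⟨M, N, h5, h6, fun m hm n hn => eventually_aux hA (h m hm n hn)⟩
end

section
/- Let P be a partially ordered set. A subset X ⊆ P is O₁-closed if and only if it is O₂-closed. (Equivalently, the order topologies τ_{O₁}(P) and τ_{O₂}(P), whose closed sets are respectively the O₁-closed and the O₂-closed sets, coincide.) -/
universe u

/-- A subset of a poset is O₁-closed if and only if it is O₂-closed; that is, the order
topologies `τ_{O₁}(P)` and `τ_{O₂}(P)` coincide. -/
theorem o1Closed_iff_o2Closed {P : Type u} [PartialOrder P] (X : Set P) :
    O1Closed X ↔ O2Closed X := by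
  constructor
  · intro h Γ _ _ _ x hx a hc
    obtain ⟨M, N, hM, hMd, hN, hNd, hMa, hNa, hev⟩ := hc
    choose g hg using hev
    have : Nonempty M := hM.to_subtype
    have : Nonempty N := hN.to_subtype
    have : IsDirected (M × (N)ᵒᵈ) (· ≤ ·) := by
      refine ⟨fun p q => ?_⟩
      obtain ⟨m, hm, h1, h2⟩ := hMd p.1 p.1.2 q.1 q.1.2
      obtain ⟨n, hn, h3, h4⟩ := hNd (OrderDual.ofDual p.2 : N) (OrderDual.ofDual p.2).2
        (OrderDual.ofDual q.2 : N) (OrderDual.ofDual q.2).2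
      exact ⟨(⟨m, hm⟩, OrderDual.toDual ⟨n, hn⟩), ⟨h1, h3⟩, ⟨h2, h4⟩⟩
    refine h (M × (N)ᵒᵈ) (fun p => x (g p.1 p.1.2 (OrderDual.ofDual p.2 : N)
      (OrderDual.ofDual p.2).2)) (fun p => hx _) a ?_
    refine ⟨fun p => p.1, fun p => (OrderDual.ofDual p.2 : N), fun p q hpq => hpq.1,
      fun p q hpq => hpq.2, ?_, ?_, Classical.arbitrary _, fun p _ => hg _ _ _ _ _ le_rfl⟩
    · convert hMa using 1
      ext m
      constructor
      · rintro ⟨p, rfl⟩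
        exact p.1.2
      · intro hm
        exact ⟨(⟨m, hm⟩, Classical.arbitrary _), rfl⟩
    · convert hNa using 1
      ext n
      constructor
      · rintro ⟨p, rfl⟩
        exact (OrderDual.ofDual p.2).2
      · intro hn
        exact ⟨(Classical.arbitrary _, OrderDual.toDual ⟨n, hn⟩), rfl⟩
  · intro h Γ _ _ _ x hx a hc
    obtain ⟨y, z, hy, hz, hya, hza, γ₀, hev⟩ := hc
    refine h Γ x hx a ⟨Set.range y, Set.range z, Set.range_nonempty y, ?_,
      Set.range_nonempty z, ?_, hya, hza, ?_⟩
    · rintro _ ⟨b, rfl⟩ _ ⟨c, rfl⟩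
      obtain ⟨d, hb, hd⟩ := exists_ge_ge b c
      exact ⟨y d, ⟨d, rfl⟩, hy hb, hy hd⟩
    · rintro _ ⟨b, rfl⟩ _ ⟨c, rfl⟩
      obtain ⟨d, hb, hd⟩ := exists_ge_ge b c
      exact ⟨z d, ⟨d, rfl⟩, hz hb, hz hd⟩
    · rintro _ ⟨b, rfl⟩ _ ⟨c, rfl⟩
      obtain ⟨d, hb, hd⟩ := exists_ge_ge b c
      obtain ⟨e, h1, h2⟩ := exists_ge_ge d γ₀
      refine ⟨e, fun γ hγ => ?_⟩
      obtain ⟨h3, h4⟩ := hev γ (h2.trans hγ)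
      exact ⟨(hy (hb.trans (h1.trans hγ))).trans h3, h4.trans (hz (hd.trans (h1.trans hγ)))⟩
end

section
/- Let P be a partially ordered set, i ∈ {1, 2, 3}, and let τ^ω_{Oᵢ}(P) be the topology on P whose closed sets are the sequentially Oᵢ-closed sets. If a sequence (x_n)_{n∈ℕ} in P converges to x ∈ P with respect to the topology τ^ω_{Oᵢ}(P), then there exists a subsequence (x_{n_k})_{k∈ℕ} that Oᵢ-converges to x. -/
universe u

/-- `X` is sequentially O₁-closed: no sequence in `X` O₁-converges to a point outside `X`. -/
def SeqO1Closed {P : Type*} [PartialOrder P] (X : Set P) : Prop :=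
  ∀ x : ℕ → P, (∀ n, x n ∈ X) → ∀ a : P, O1Converges x a → a ∈ X

/-- `X` is sequentially O₂-closed. -/
def SeqO2Closed {P : Type*} [PartialOrder P] (X : Set P) : Prop :=
  ∀ x : ℕ → P, (∀ n, x n ∈ X) → ∀ a : P, O2Converges x a → a ∈ X

/-- `X` is sequentially O₃-closed. -/
def SeqO3Closed {P : Type*} [PartialOrder P] (X : Set P) : Prop :=
  ∀ x : ℕ → P, (∀ n, x n ∈ X) → ∀ a : P, O3Converges x a → a ∈ X

open Filter in
theorem key_closed {P : Type*} (Conv : (ℕ → P) → P → Prop)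
    (hsub : ∀ y c φ, StrictMono φ → Conv y c → Conv (fun k => y (φ k)) c)
    (huniq : ∀ y c d, Conv y c → Conv y d → c = d)
    (hconst : ∀ c, Conv (fun _ => c) c)
    (z : ℕ → P) (S : Set P) (hS : S.Finite)
    (hz : ∀ φ : ℕ → ℕ, StrictMono φ → ∀ c, Conv (fun k => z (φ k)) c → c ∈ S)
    (y : ℕ → P) (hy : ∀ n, y n ∈ Set.range z ∪ S) (c : P) (hc : Conv y c) :
    c ∈ Set.range z ∪ S := by
  by_contra hcF
  have hne : ∀ v ∈ Set.range z ∪ S, ∀ᶠ n in atTop, y n ≠ v := by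
    intro v hv
    by_contra hf
    have hf' : ∃ᶠ n in atTop, y n = v := by
      simpa [Filter.Frequently] using hf
    obtain ⟨φ, hφ, hφv⟩ := extraction_of_frequently_atTop hf'
    have h1 := hsub y c φ hφ hc
    have h2 : (fun k => y (φ k)) = fun _ => v := funext hφv
    rw [h2] at h1
    exact hcF (huniq _ _ _ h1 (hconst v) ▸ hv)
  have h1 : ∀ᶠ n in atTop, ∀ s ∈ S, y n ≠ s :=
    (eventually_all_finite hS).2 fun s hs => hne s (Or.inr hs)
  have h2 : ∀ n, ∃ k, (∀ s ∈ S, y n ≠ s) → z k = y n := by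
    intro n
    rcases hy n with ⟨k, hk⟩ | h
    · exact ⟨k, fun _ => hk⟩
    · exact ⟨0, fun h' => absurd rfl (h' _ h)⟩
  choose k hk using h2
  have h3 : Tendsto k atTop atTop := by
    rw [tendsto_atTop]
    intro N
    have : ∀ᶠ n in atTop, ∀ i ∈ {i : ℕ | i < N}, y n ≠ z i :=
      (eventually_all_finite (Set.finite_lt_nat N)).2 fun i _ => hne _ (Or.inl ⟨i, rfl⟩)
    filter_upwards [this, h1] with n hn hn1
    by_contra hlt
    exact hn (k n) (not_le.1 hlt) (hk n hn1).symm
  obtain ⟨N, hN⟩ := eventually_atTop.1 h1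
  have h4 : Tendsto (fun n => k (n + N)) atTop atTop := h3.comp (tendsto_add_atTop_nat N)
  obtain ⟨φ, hφ, hkφ⟩ := strictMono_subseq_of_tendsto_atTop h4
  have h5 := hsub y c (fun n => φ n + N) (fun i j h => Nat.add_lt_add_right (hφ h) N) hc
  have h6 : (fun n => y (φ n + N)) = fun n => z (k (φ n + N)) :=
    funext fun n => (hk _ (hN _ (Nat.le_add_left _ _))).symm
  rw [h6] at h5
  exact hcF (Or.inr (hz (fun n => k (φ n + N)) hkφ c h5))

open Filter in
theorem key_subseq {P : Type*} (Conv : (ℕ → P) → P → Prop)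
    (hsub : ∀ y c φ, StrictMono φ → Conv y c → Conv (fun k => y (φ k)) c)
    (huniq : ∀ y c d, Conv y c → Conv y d → c = d)
    (hconst : ∀ c, Conv (fun _ => c) c)
    (E : Set P) (hE : E.Finite) (x : ℕ → P) (a : P) (ha : a ∉ E)
    (h : ∀ F : Set P, E ⊆ F → (∀ y : ℕ → P, (∀ n, y n ∈ F) → ∀ c, Conv y c → c ∈ F) →
      a ∉ F → ∃ N, ∀ n, N ≤ n → x n ∉ F) :
    ∃ φ : ℕ → ℕ, StrictMono φ ∧ Conv (fun k => x (φ k)) a := by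
  by_cases hf : ∃ᶠ n in atTop, x n = a
  · obtain ⟨φ, hφ, hφv⟩ := extraction_of_frequently_atTop hf
    refine ⟨φ, hφ, ?_⟩
    rw [show (fun k => x (φ k)) = fun _ => a from funext hφv]
    exact hconst a
  by_contra hno
  push Not at hno
  obtain ⟨N, hN⟩ := eventually_atTop.1 (not_frequently.1 hf)
  -- a subsequence avoiding `a`, all of whose subsequential limits lie in a finite set
  have main : ∃ ψ : ℕ → ℕ, StrictMono ψ ∧ (∀ n, x (ψ n) ≠ a) ∧ ∃ S : Set P, S.Finite ∧ a ∉ S ∧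
      E ⊆ S ∧ ∀ φ : ℕ → ℕ, StrictMono φ → ∀ c, Conv (fun k => x (ψ (φ k))) c → c ∈ S := by
    have hs : StrictMono fun n => n + N := fun i j h => Nat.add_lt_add_right h N
    by_cases hb : ∃ φ : ℕ → ℕ, StrictMono φ ∧ ∃ b, Conv (fun k => x (φ k + N)) b
    · obtain ⟨φ, hφ, b, hb⟩ := hb
      refine ⟨fun n => φ n + N, hs.comp hφ, fun n => hN _ (Nat.le_add_left _ _),
        insert b E, hE.insert b, ?_, Set.subset_insert _ _, ?_⟩
      · rintro (rfl | h')
        · exact hno _ (hs.comp hφ) hb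
        · exact ha h'
      · intro θ hθ c hc
        exact Or.inl (huniq _ _ _ hc (hsub _ b θ hθ hb))
    · push Not at hb
      exact ⟨fun n => n + N, hs, fun n => hN _ (Nat.le_add_left _ _), E, hE, ha, subset_rfl,
        fun φ hφ c hc => absurd hc (hb φ hφ c)⟩
  obtain ⟨ψ, hψ, hψa, S, hS, haS, hES, hlim⟩ := main
  obtain ⟨M, hM⟩ := h (Set.range (fun n => x (ψ n)) ∪ S) (fun e he => Or.inr (hES he))
    (fun y hy c hc => key_closed Conv hsub huniq hconst (fun n => x (ψ n)) S hS hlim y hy c hc)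
    (by
      rintro (⟨n, hn⟩ | h')
      · exact hψa n hn
      · exact haS h')
  exact hM (ψ M) (hψ.id_le M) (Or.inl ⟨M, rfl⟩)

/-- Proper O₃-convergence: the witnessing sets are nonempty. -/
def O3Proper {P : Type*} [PartialOrder P] (x : ℕ → P) (a : P) : Prop :=
  ∃ M N : Set P, M.Nonempty ∧ N.Nonempty ∧ IsLUB M a ∧ IsGLB N a ∧
    ∀ m ∈ M, ∀ n ∈ N, ∃ γ₀, ∀ γ, γ₀ ≤ γ → m ≤ x γ ∧ x γ ≤ n

theorem O3Proper.le {P : Type*} [PartialOrder P] {x : ℕ → P} {a b : P}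
    (ha : O3Proper x a) (hb : O3Proper x b) : a ≤ b := by
  obtain ⟨M, N, ⟨m₀, hm₀⟩, ⟨n₀, hn₀⟩, hM, hN, h⟩ := ha
  obtain ⟨M', N', ⟨m₁, hm₁⟩, ⟨n₁, hn₁⟩, hM', hN', h'⟩ := hb
  refine hM.2 fun m hm => hN'.2 fun n hn => ?_
  obtain ⟨i, hi⟩ := h m hm n₀ hn₀
  obtain ⟨j, hj⟩ := h' m₁ hm₁ n hn
  exact (hi (max i j) (le_max_left _ _)).1.trans (hj (max i j) (le_max_right _ _)).2

theorem O3Proper.uniq {P : Type*} [PartialOrder P] {x : ℕ → P} {a b : P}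
    (ha : O3Proper x a) (hb : O3Proper x b) : a = b := le_antisymm (ha.le hb) (hb.le ha)

theorem O2Converges.proper {P : Type*} [PartialOrder P] {x : ℕ → P} {a : P}
    (h : O2Converges x a) : O3Proper x a := by
  obtain ⟨M, N, h1, -, h2, -, h3⟩ := h
  exact ⟨M, N, h1, h2, h3⟩

theorem O1Converges.proper {P : Type*} [PartialOrder P] {x : ℕ → P} {a : P}
    (h : O1Converges x a) : O3Proper x a := by
  obtain ⟨y, z, hy, hz, h1, h2, i, hi⟩ := h
  refine ⟨_, _, Set.range_nonempty y, Set.range_nonempty z, h1, h2, ?_⟩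
  rintro _ ⟨p, rfl⟩ _ ⟨q, rfl⟩
  refine ⟨max i (max p q), fun n hn => ?_⟩
  have h3 := hi n (le_of_max_le_left hn)
  have h4 := le_of_max_le_right hn
  exact ⟨(hy (le_of_max_le_left h4)).trans h3.1, h3.2.trans (hz (le_of_max_le_right h4))⟩

theorem ev_subseq {p : ℕ → Prop} {φ : ℕ → ℕ} (hφ : StrictMono φ)
    (h : ∃ i, ∀ n, i ≤ n → p n) : ∃ i, ∀ n, i ≤ n → p (φ n) := by
  obtain ⟨i, hi⟩ := h
  exact ⟨i, fun n hn => hi _ (hn.trans (hφ.id_le n))⟩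

theorem O1Converges.subseq {P : Type*} [PartialOrder P] (x : ℕ → P) (a : P) (φ : ℕ → ℕ)
    (hφ : StrictMono φ) (h : O1Converges x a) : O1Converges (fun k => x (φ k)) a := by
  obtain ⟨y, z, hy, hz, h1, h2, h3⟩ := h
  refine ⟨fun k => y (φ k), fun k => z (φ k), hy.comp hφ.monotone,
    hz.comp_monotone hφ.monotone, ⟨?_, ?_⟩, ⟨?_, ?_⟩, ev_subseq hφ h3⟩
  · rintro _ ⟨k, rfl⟩
    exact h1.1 ⟨_, rfl⟩
  · intro u hu
    refine h1.2 ?_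
    rintro _ ⟨k, rfl⟩
    exact (hy (hφ.id_le k)).trans (hu ⟨k, rfl⟩)
  · rintro _ ⟨k, rfl⟩
    exact h2.1 ⟨_, rfl⟩
  · intro u hu
    refine h2.2 ?_
    rintro _ ⟨k, rfl⟩
    exact le_trans (hu ⟨k, rfl⟩) (hz (hφ.id_le k))

theorem O2Converges.subseq {P : Type*} [PartialOrder P] (x : ℕ → P) (a : P) (φ : ℕ → ℕ)
    (hφ : StrictMono φ) (h : O2Converges x a) : O2Converges (fun k => x (φ k)) a := by
  obtain ⟨M, N, h1, h2, h3, h4, h5, h6, h7⟩ := h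
  exact ⟨M, N, h1, h2, h3, h4, h5, h6, fun m hm n hn => ev_subseq hφ (h7 m hm n hn)⟩

theorem O3Proper.subseq {P : Type*} [PartialOrder P] (x : ℕ → P) (a : P) (φ : ℕ → ℕ)
    (hφ : StrictMono φ) (h : O3Proper x a) : O3Proper (fun k => x (φ k)) a := by
  obtain ⟨M, N, h1, h3, h5, h6, h7⟩ := h
  exact ⟨M, N, h1, h3, h5, h6, fun m hm n hn => ev_subseq hφ (h7 m hm n hn)⟩

theorem O1Converges.const {P : Type*} [PartialOrder P] (a : P) :
    O1Converges (fun _ : ℕ => a) a :=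
  ⟨fun _ => a, fun _ => a, monotone_const, antitone_const, by simp, by simp,
    0, fun _ _ => ⟨le_rfl, le_rfl⟩⟩

theorem O2Converges.const {P : Type*} [PartialOrder P] (a : P) :
    O2Converges (fun _ : ℕ => a) a := by
  refine ⟨{a}, {a}, by simp, ?_, by simp, ?_, by simp, by simp, ?_⟩
  · rintro _ rfl _ rfl
    exact ⟨_, rfl, le_rfl, le_rfl⟩
  · rintro _ rfl _ rfl
    exact ⟨_, rfl, le_rfl, le_rfl⟩
  · rintro _ rfl _ rfl
    exact ⟨0, fun _ _ => ⟨le_rfl, le_rfl⟩⟩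

theorem extremes_finite {P : Type*} [PartialOrder P] :
    {e : P | IsBot e ∨ IsTop e}.Finite := by
  have h1 : {e : P | IsBot e}.Subsingleton := fun p hp q hq => le_antisymm (hp q) (hq p)
  have h2 : {e : P | IsTop e}.Subsingleton := fun p hp q hq => le_antisymm (hq p) (hp q)
  exact h1.finite.union h2.finite

theorem O3Converges.proper_or {P : Type*} [PartialOrder P] {x : ℕ → P} {a : P}
    (h : O3Converges x a) : O3Proper x a ∨ a ∈ {e : P | IsBot e ∨ IsTop e} := by
  obtain ⟨M, N, h1, h2, h3⟩ := h
  rcases M.eq_empty_or_nonempty with rfl | hM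
  · exact Or.inr (Or.inl (isLUB_empty_iff.1 h1))
  rcases N.eq_empty_or_nonempty with rfl | hN
  · exact Or.inr (Or.inr (isGLB_empty_iff.1 h2))
  exact Or.inl ⟨M, N, hM, hN, h1, h2, h3⟩

theorem O3Converges.of_extreme {P : Type*} [PartialOrder P] (x : ℕ → P) {a : P}
    (h : IsBot a ∨ IsTop a) : O3Converges x a := by
  rcases h with h | h
  · exact ⟨∅, {a}, isLUB_empty_iff.2 h, isGLB_singleton, by simp⟩
  · exact ⟨{a}, ∅, isLUB_singleton, isGLB_empty_iff.2 h, by simp⟩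

theorem O3Proper.o3 {P : Type*} [PartialOrder P] {x : ℕ → P} {a : P}
    (h : O3Proper x a) : O3Converges x a := by
  obtain ⟨M, N, -, -, h⟩ := h
  exact ⟨M, N, h⟩

/-- If a sequence converges to `a` with respect to the topology `τ^ω_{Oᵢ}(P)` whose closed
sets are the sequentially Oᵢ-closed sets (i.e. for every set `U` with sequentially Oᵢ-closed
complement and containing `a`, the sequence is eventually in `U`), then some subsequence
Oᵢ-converges to `a` (for each `i ∈ {1, 2, 3}`). -/
theorem subsequence_oi_converges_of_tendsto_tau_omega {P : Type*} [PartialOrder P]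
    (x : ℕ → P) (a : P) :
    ((∀ U : Set P, SeqO1Closed Uᶜ → a ∈ U → ∃ N, ∀ n, N ≤ n → x n ∈ U) →
      ∃ φ : ℕ → ℕ, StrictMono φ ∧ O1Converges (fun k => x (φ k)) a) ∧
    ((∀ U : Set P, SeqO2Closed Uᶜ → a ∈ U → ∃ N, ∀ n, N ≤ n → x n ∈ U) →
      ∃ φ : ℕ → ℕ, StrictMono φ ∧ O2Converges (fun k => x (φ k)) a) ∧
    ((∀ U : Set P, SeqO3Closed Uᶜ → a ∈ U → ∃ N, ∀ n, N ≤ n → x n ∈ U) →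
      ∃ φ : ℕ → ℕ, StrictMono φ ∧ O3Converges (fun k => x (φ k)) a) := by
  refine ⟨fun h => ?_, fun h => ?_, fun h => ?_⟩
  · refine key_subseq (fun y c => O1Converges y c) O1Converges.subseq
      (fun _ _ _ h1 h2 => h1.proper.uniq h2.proper) O1Converges.const ∅ Set.finite_empty x a
      (by simp) fun F _ hF haF => h Fᶜ ?_ haF
    rw [compl_compl]
    exact hF
  · refine key_subseq (fun y c => O2Converges y c) O2Converges.subseq
      (fun _ _ _ h1 h2 => h1.proper.uniq h2.proper) O2Converges.const ∅ Set.finite_empty x a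
      (by simp) fun F _ hF haF => h Fᶜ ?_ haF
    rw [compl_compl]
    exact hF
  · by_cases ha : IsBot a ∨ IsTop a
    · exact ⟨id, strictMono_id, O3Converges.of_extreme _ ha⟩
    obtain ⟨φ, hφ, hc⟩ := key_subseq (fun y c => O3Proper y c) O3Proper.subseq
      (fun _ _ _ h1 h2 => h1.uniq h2) (fun c => (O2Converges.const c).proper)
      {e : P | IsBot e ∨ IsTop e} extremes_finite x a ha fun F hEF hF haF => h Fᶜ (by
        rw [compl_compl]
        intro y hy c hc
        rcases hc.proper_or with h' | h'
        · exact hF y hy c h'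
        · exact hEF h') haF
    exact ⟨φ, hφ, hc.o3⟩
end

section
/- There exist a countable partially ordered set P, a sequence (x_n)_{n∈ℕ} in P, and a point x ∈ P such that (x_n) O₃-converges to x but (x_n) does not O₂-converge to x. (Wolk's example: O₃-convergence is strictly weaker than O₂-convergence in general posets.) -/
universe u

/-- Underlying type of the example: a top `none`, lower points `inl k`, sequence points `inr n`. -/
abbrev WolkP : Type := Option (ℕ ⊕ ℕ)

/-- The order: `inl k ≤ inr n` iff `k ≤ n`, everything is below `none`. -/
def WolkLe : WolkP → WolkP → Prop
  | _, none => True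
  | none, some _ => False
  | some (.inl k), some (.inl l) => k = l
  | some (.inl k), some (.inr n) => k ≤ n
  | some (.inr _), some (.inl _) => False
  | some (.inr m), some (.inr n) => m = n

/-- The partial order on the example. -/
@[reducible] def wolkOrder : PartialOrder WolkP where
  le := WolkLe
  lt a b := WolkLe a b ∧ ¬ WolkLe b a
  lt_iff_le_not_ge _ _ := Iff.rfl
  le_refl a := by rcases a with _ | _ | _ <;> simp [WolkLe]
  le_trans a b c := by
    rcases a with _ | _ | _ <;> rcases b with _ | _ | _ <;> rcases c with _ | _ | _ <;>
      simp [WolkLe] <;> omega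
  le_antisymm a b := by
    rcases a with _ | _ | _ <;> rcases b with _ | _ | _ <;> simp [WolkLe] <;> omega

/-- Wolk's example: there are a countable poset `P`, a sequence in `P` and a point `a ∈ P`
such that the sequence O₃-converges to `a` but does not O₂-converge to `a`. -/
theorem exists_o3_not_o2 :
    ∃ (P : Type) (inst : PartialOrder P) (_ : Countable P) (x : ℕ → P) (a : P),
      @O3Converges P inst ℕ _ x a ∧ ¬ @O2Converges P inst ℕ _ x a := by
  refine ⟨WolkP, wolkOrder, inferInstance, fun n => some (.inr n), none, ?_, ?_⟩
  · refine ⟨Set.range fun k => some (.inl k), {none}, ⟨?_, ?_⟩, ⟨?_, ?_⟩, ?_⟩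
    · rintro _ ⟨k, rfl⟩
      exact trivial
    · rintro (_ | l | n) hb
      · exact trivial
      · have h : l + 1 = l := hb ⟨l + 1, rfl⟩
        omega
      · have h : n + 1 ≤ n := hb ⟨n + 1, rfl⟩
        omega
    · rintro _ rfl
      exact trivial
    · intro b hb
      exact hb rfl
    · rintro _ ⟨k, rfl⟩ _ rfl
      exact ⟨k, fun n hn => ⟨hn, trivial⟩⟩
  · rintro ⟨M, N, ⟨m, hm⟩, hdir, ⟨n, hn⟩, -, hM, -, hev⟩
    have key : ∀ p ∈ M, ∃ k, p = some (.inl k) := by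
      intro p hp
      obtain ⟨g, hg⟩ := hev p hp n hn
      rcases p with _ | k | j
      · exact (hg g le_rfl).1.elim
      · exact ⟨k, rfl⟩
      · have h1 : j = g := (hg g le_rfl).1
        have h2 : j = g + 1 := (hg (g + 1) (Nat.le_succ g)).1
        omega
    have hub : m ∈ @upperBounds WolkP wolkOrder.toLE M := by
      intro p hp
      obtain ⟨c, hc, h1, h2⟩ := hdir m hm p hp
      obtain ⟨i, rfl⟩ := key m hm
      obtain ⟨j, rfl⟩ := key p hp
      obtain ⟨k, rfl⟩ := key c hc
      have e1 : i = k := h1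
      have e2 : j = k := h2
      exact e2.trans e1.symm
    have h := hM.2 hub
    obtain ⟨i, rfl⟩ := key m hm
    exact h
end

section
/- There exist a lattice L, a sequence (f_n)_{n∈ℕ} in L, and a point x ∈ L such that (f_n) O₂-converges to x but (f_n) does not O₁-converge to x. (Fremlin's example, realized in the Banach lattice C(X₀, ℝ) of continuous real functions on the one-point compactification X₀ of an uncountable discrete space: O₂-convergence is strictly weaker than O₁-convergence even in lattices.) -/
universe u

/-- Finite or cofinite subsets of the real line. -/
def FinCofin (s : Set ℝ) : Prop := s.Finite ∨ sᶜ.Finite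

theorem FinCofin.union {s t : Set ℝ} (hs : FinCofin s) (ht : FinCofin t) :
    FinCofin (s ⊔ t) := by
  rcases hs with hs | hs
  · rcases ht with ht | ht
    · exact Or.inl (hs.union ht)
    · exact Or.inr (ht.subset (Set.compl_subset_compl.2 Set.subset_union_right))
  · exact Or.inr (hs.subset (Set.compl_subset_compl.2 Set.subset_union_left))

theorem FinCofin.inter {s t : Set ℝ} (hs : FinCofin s) (ht : FinCofin t) :
    FinCofin (s ⊓ t) := by
  rcases hs with hs | hs
  · exact Or.inl (hs.subset Set.inter_subset_left)
  · rcases ht with ht | ht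
    · exact Or.inl (ht.subset Set.inter_subset_right)
    · refine Or.inr ?_
      change (s ∩ t)ᶜ.Finite
      rw [Set.compl_inter]
      exact hs.union ht

/-- Fremlin's example: there are a lattice `L`, a sequence in `L` and a point `a ∈ L` such
that the sequence O₂-converges to `a` but does not O₁-converge to `a` (it can be realized in
the Banach lattice `C(X₀, ℝ)` for `X₀` the one-point compactification of an uncountable
discrete space). -/
theorem exists_o2_not_o1 :
    ∃ (L : Type) (inst : Lattice L) (f : ℕ → L) (a : L),
      @O2Converges L inst.toSemilatticeSup.toPartialOrder ℕ _ f a ∧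
        ¬ @O1Converges L inst.toSemilatticeSup.toPartialOrder ℕ _ f a := by
  let inst : Lattice {s : Set ℝ // FinCofin s} :=
    Subtype.lattice (fun _ _ hs ht => hs.union ht) (fun _ _ hs ht => hs.inter ht)
  let e : {s : Set ℝ // FinCofin s} := ⟨∅, Or.inl Set.finite_empty⟩
  let f : ℕ → {s : Set ℝ // FinCofin s} := fun n => ⟨{(n : ℝ)}, Or.inl (Set.finite_singleton _)⟩
  have he : ∀ s : {s : Set ℝ // FinCofin s}, e ≤ s := fun s => Set.empty_subset s.1
  refine ⟨_, inst, f, e, ?_, ?_⟩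
  · refine ⟨{e}, {s | (s.1)ᶜ.Finite}, ⟨e, rfl⟩, ?_, ?_, ?_, ?_, ?_, ?_⟩
    · rintro a rfl b rfl
      exact ⟨e, rfl, le_refl _, le_refl _⟩
    · exact ⟨⟨Set.univ, Or.inr (by simp)⟩, by simp⟩
    · intro a ha b hb
      refine ⟨a ⊓ b, ?_, inf_le_left, inf_le_right⟩
      change (a.1 ∩ b.1)ᶜ.Finite
      rw [Set.compl_inter]
      exact Set.Finite.union ha hb
    · exact isLUB_singleton
    · refine ⟨fun s _ => he s, fun b hb x hx => ?_⟩
      have h : ({x}ᶜ : Set ℝ)ᶜ.Finite := by simp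
      have h2 : b ≤ (⟨{x}ᶜ, Or.inr h⟩ : {s : Set ℝ // FinCofin s}) := hb h
      exact absurd rfl (h2 hx)
    · rintro m rfl n hn
      have h1 : {k : ℕ | (k : ℝ) ∈ (n.1)ᶜ}.Finite :=
        Set.Finite.preimage (Nat.cast_injective.injOn) hn
      obtain ⟨B, hB⟩ := h1.bddAbove
      refine ⟨B + 1, fun k hk => ⟨he _, ?_⟩⟩
      have : (k : ℝ) ∈ n.1 := by
        by_contra hc
        have : k ≤ B := hB hc
        omega
      exact Set.singleton_subset_iff.2 this
  · rintro ⟨y, z, -, hz, -, hglb, N, hN⟩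
    have hcof : ∀ n, ((z n).1)ᶜ.Finite := by
      intro n
      refine (z n).2.resolve_left fun hfin => ?_
      have hsub : (fun k : ℕ => (k : ℝ)) '' Set.Ici (max n N) ⊆ (z n).1 := by
        rintro _ ⟨k, hk, rfl⟩
        have hk' : max n N ≤ k := hk
        have h1 : f k ≤ z n :=
          ((hN k (le_trans (le_max_right _ _) hk')).2).trans
            (hz (le_trans (le_max_left _ _) hk'))
        exact h1 rfl
      exact (Set.infinite_of_injective_forall_mem (f := fun k : ℕ => ((k + max n N : ℕ) : ℝ))
        (fun a b h => by simpa using h)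
        (fun k => hsub ⟨k + max n N, Nat.le_add_left _ _, rfl⟩)) hfin
    have hcount : (⋃ n, ((z n).1)ᶜ).Countable := Set.countable_iUnion fun n => (hcof n).countable
    obtain ⟨p, hp⟩ : ∃ p, p ∉ ⋃ n, ((z n).1)ᶜ := by
      by_contra! hc
      exact Set.not_countable_univ_iff.2 inferInstance (hcount.mono fun x _ => hc x)
    simp only [Set.mem_iUnion, not_exists, Set.mem_compl_iff, not_not] at hp
    have hle : (⟨{p}, Or.inl (Set.finite_singleton _)⟩ : {s : Set ℝ // FinCofin s}) ≤ e := by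
      apply hglb.2
      rintro _ ⟨n, rfl⟩
      exact Set.singleton_subset_iff.2 (hp n)
    exact hle (Set.mem_singleton p)
end

section
/- Let (X, Σ, μ) be a σ-finite measure space. Let (f_n)_{n∈ℕ} be a sequence in L^∞(μ) with ‖f_n‖_{L^∞(μ)} ≤ C for all n and some constant C ≥ 0, and let f ∈ L^∞(μ). Suppose (f_n) converges to f in measure on every set of finite measure, i.e., for every measurable E with μ(E) < ∞ the sequence (f_n) tends to f in measure with respect to the restricted measure μ|_E. Then there exists a subsequence (f_{n_k})_{k∈ℕ} that O₁-converges to f in the partially ordered set L^∞(μ) with the μ-a.e. pointwise order. (This is the key step showing that on bounded parts of L^∞ the topology of convergence in measure coincides with the order topology when μ is σ-finite.) -/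
open MeasureTheory ENNReal

/-- Along a sequence converging a.e. and bounded, the tail suprema decrease to the limit. -/
theorem exists_upper_aux {X : Type*} [MeasurableSpace X]
    (μ : Measure X) (C : ℝ) (F : ℕ → Lp ℝ ∞ μ) (hF : ∀ n, ‖F n‖ ≤ C) (g : Lp ℝ ∞ μ)
    (h : ∀ᵐ x ∂μ, Filter.Tendsto (fun n => F n x) Filter.atTop (nhds (g x))) :
    ∃ z : ℕ → Lp ℝ ∞ μ, Antitone z ∧ IsGLB (Set.range z) g ∧ ∀ n, F n ≤ z n := by
  have hb : ∀ᵐ x ∂μ, ∀ n, |F n x| ≤ C := by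
    rw [ae_all_iff]
    intro n
    have h1 := ae_le_eLpNormEssSup (f := ⇑(F n)) (μ := μ)
    have h2 : eLpNormEssSup (F n) μ ≤ ENNReal.ofReal C := by
      rw [← eLpNorm_exponent_top, ← Lp.enorm_def, ← ofReal_norm]
      exact ENNReal.ofReal_le_ofReal (hF n)
    have hC : 0 ≤ C := (norm_nonneg _).trans (hF n)
    filter_upwards [h1] with x hx
    have := hx.trans h2
    rw [← ofReal_norm, ENNReal.ofReal_le_ofReal_iff hC] at this
    simpa using this
  have hbdd : ∀ x, (∀ n, |F n x| ≤ C) → ∀ n, BddAbove (Set.range fun k => F (n + k) x) := by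
    rintro x hx n
    refine ⟨C, ?_⟩
    rintro _ ⟨k, rfl⟩
    exact (abs_le.1 (hx _)).2
  have hm : ∀ n, MemLp (fun x => ⨆ k, F (n + k) x) ∞ μ := by
    intro n
    refine memLp_top_of_bound
      (Measurable.iSup fun k => (Lp.stronglyMeasurable (F (n + k))).measurable).aestronglyMeasurable
      C ?_
    filter_upwards [hb] with x hx
    rw [Real.norm_eq_abs, abs_le]
    exact ⟨(abs_le.1 (hx (n + 0))).1.trans (le_ciSup (hbdd x hx n) 0),
      ciSup_le fun k => (abs_le.1 (hx _)).2⟩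
  have hz : ∀ᵐ x ∂μ, ∀ n, (hm n).toLp _ x = ⨆ k, F (n + k) x :=
    ae_all_iff.2 fun n => (hm n).coeFn_toLp
  refine ⟨fun n => (hm n).toLp _, ?_, ⟨?_, ?_⟩, ?_⟩
  · intro m n hmn
    rw [← Lp.coeFn_le]
    filter_upwards [hb, hz] with x hx hzx
    simp only [hzx]
    refine ciSup_le fun k => ?_
    have := le_ciSup (hbdd x hx m) (n - m + k)
    rwa [show m + (n - m + k) = n + k by omega] at this
  · rintro _ ⟨n, rfl⟩
    rw [← Lp.coeFn_le]
    filter_upwards [hb, hz, h] with x hx hzx hl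
    simp only [hzx]
    refine le_of_tendsto hl ?_
    filter_upwards [Filter.eventually_ge_atTop n] with j hj
    have := le_ciSup (hbdd x hx n) (j - n)
    rwa [show n + (j - n) = j by omega] at this
  · intro w hw
    have hw' : ∀ᵐ x ∂μ, ∀ n, w x ≤ (hm n).toLp _ x :=
      ae_all_iff.2 fun n => (Lp.coeFn_le _ _).2 (hw ⟨n, rfl⟩)
    rw [← Lp.coeFn_le]
    filter_upwards [hz, h, hw'] with x hzx hl hwx
    refine le_of_forall_pos_le_add fun ε hε => ?_
    obtain ⟨N, hN⟩ := Filter.eventually_atTop.1 (hl.eventually (ge_mem_nhds (lt_add_of_pos_right (g x) hε)))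
    refine (hwx N).trans ?_
    rw [hzx]
    exact ciSup_le fun k => hN _ (Nat.le_add_right _ _)
  · intro n
    rw [← Lp.coeFn_le]
    filter_upwards [hb, hz] with x hx hzx
    rw [hzx]
    exact le_ciSup (hbdd x hx n) 0

/-- Let `μ` be σ-finite, `(f n)` a norm-bounded sequence in `L^∞(μ)` converging to
`g ∈ L^∞(μ)` in measure on every set of finite measure.  Then some subsequence of `(f n)`
O₁-converges to `g` in the μ-a.e. pointwise order of `L^∞(μ)`. -/
theorem exists_subseq_o1Converges_of_tendstoInMeasure {X : Type*} [MeasurableSpace X]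
    (μ : Measure X) [SigmaFinite μ] (C : ℝ) (hC : 0 ≤ C)
    (f : ℕ → Lp ℝ ∞ μ) (hf : ∀ n, ‖f n‖ ≤ C) (g : Lp ℝ ∞ μ)
    (hconv : ∀ E : Set X, MeasurableSet E → μ E < ∞ →
      TendstoInMeasure (μ.restrict E) (fun n => ⇑(f n)) Filter.atTop ⇑g) :
    ∃ φ : ℕ → ℕ, StrictMono φ ∧ O1Converges (fun k => f (φ k)) g := by
  have key : ∃ φ : ℕ → ℕ, StrictMono φ ∧ ∀ k, μ.restrict (spanningSets μ k)
      {x | (1 / 2 : ℝ) ^ k ≤ dist (f (φ k) x) (g x)} ≤ (1 / 2 : ℝ≥0∞) ^ k := by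
    refine Filter.extraction_forall_of_eventually (P := fun k n => μ.restrict (spanningSets μ k)
      {x | (1 / 2 : ℝ) ^ k ≤ dist (f n x) (g x)} ≤ (1 / 2 : ℝ≥0∞) ^ k) fun k => ?_
    have h1 := hconv _ (measurableSet_spanningSets μ k) (measure_spanningSets_lt_top μ k)
    rw [tendstoInMeasure_iff_dist] at h1
    have h2 := h1 ((1 / 2 : ℝ) ^ k) (by positivity)
    refine h2.eventually (ge_mem_nhds ?_)
    exact ENNReal.pow_pos (by simp) k
  obtain ⟨φ, hφ, hk⟩ := key
  have hae : ∀ᵐ x ∂μ, Filter.Tendsto (fun n => f (φ n) x) Filter.atTop (nhds (g x)) := by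
    have hsum : ∑' k, μ ({x | (1 / 2 : ℝ) ^ k ≤ dist (f (φ k) x) (g x)} ∩ spanningSets μ k) ≠ ∞ := by
      refine ne_top_of_le_ne_top (b := ∑' k, (1 / 2 : ℝ≥0∞) ^ k) ?_ (ENNReal.tsum_le_tsum fun k => ?_)
      · rw [ENNReal.tsum_geometric]
        simp
      · rw [← Measure.restrict_apply' (measurableSet_spanningSets μ k)]
        exact hk k
    filter_upwards [ae_eventually_notMem hsum] with x hx
    rw [tendsto_iff_dist_tendsto_zero]
    refine squeeze_zero' (.of_forall fun _ => dist_nonneg) ?_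
      (tendsto_pow_atTop_nhds_zero_of_lt_one (r := (1 / 2 : ℝ)) (by norm_num) (by norm_num))
    filter_upwards [hx, Filter.eventually_ge_atTop (spanningSetsIndex μ x)] with k hxk hik
    by_contra hcon
    exact hxk ⟨(not_le.1 hcon).le, monotone_spanningSets μ hik (mem_spanningSetsIndex μ x)⟩
  obtain ⟨z, hz1, hz2, hz3⟩ := exists_upper_aux μ C (fun k => f (φ k)) (fun k => hf _) g hae
  obtain ⟨y, hy1, hy2, hy3⟩ := exists_upper_aux μ C (fun k => - f (φ k))
    (fun k => by rw [norm_neg]; exact hf _) (-g) (by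
      have h1 : ∀ᵐ x ∂μ, ∀ k, (-f (φ k) : Lp ℝ ∞ μ) x = - f (φ k) x :=
        ae_all_iff.2 fun k => Lp.coeFn_neg _
      filter_upwards [hae, h1, Lp.coeFn_neg g] with x hx h1x h2x
      simp only [h1x, h2x, Pi.neg_apply]
      exact hx.neg)
  refine ⟨φ, hφ, fun n => - y n, z, fun a b hab => neg_le_neg (hy1 hab), hz1, ⟨?_, ?_⟩, hz2, 0,
    fun k _ => ⟨neg_le.1 (hy3 k), hz3 k⟩⟩
  · rintro _ ⟨n, rfl⟩
    exact neg_le.1 (hy2.1 ⟨n, rfl⟩)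
  · intro w hw
    refine neg_le_neg_iff.1 (hy2.2 ?_)
    rintro _ ⟨n, rfl⟩
    exact neg_le.1 (hw ⟨n, rfl⟩)
end

section
/- Let (X, Σ, μ) be a semi-finite measure space (every measurable set of infinite measure contains a measurable subset of positive finite measure) and let A ∈ Σ satisfy μ(A) ≠ 0 and contain no μ-atoms (every measurable B ⊆ A with μ(B) > 0 has a measurable subset C ⊆ B with 0 < μ(C) < μ(B)). Then there exists a set F ⊆ L^∞(μ) such that: (a) 0 ∉ F; (b) F is sequentially O₁-closed in the μ-a.e. order of L^∞(μ) (no sequence in F O₁-converges to an element of L^∞(μ) outside F); and (c) for every set K of integrable functions g : X → ℝ that is norm-bounded in L¹(μ) and uniformly integrable (for every ε > 0 there is δ > 0 such that for every g ∈ K and every measurable S with μ(S) ≤ δ one has ∫_S |g| dμ ≤ ε), there exists f ∈ F with |∫ f·g dμ| ≤ 1 for every g ∈ K. (Hence F is order-closed but 0 lies in its closure in the Mackey topology τ(L^∞, L¹), so the order topology on L^∞ differs from τ(L^∞, L¹).) -/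
open MeasureTheory ENNReal

namespace OCM
def Atomless {X : Type*} [MeasurableSpace X] (ν : Measure X) : Prop :=
  ∀ S : Set X, MeasurableSet S → 0 < ν.real S →
    ∃ C : Set X, MeasurableSet C ∧ C ⊆ S ∧ 0 < ν.real C ∧ ν.real C < ν.real S

variable {X : Type*} [MeasurableSpace X] {ν : Measure X} [IsFiniteMeasure ν]

theorem exists_small (hat : Atomless ν) {S : Set X} (hS : MeasurableSet S) (h0 : 0 < ν.real S)
    {ε : ℝ} (hε : 0 < ε) :
    ∃ C : Set X, MeasurableSet C ∧ C ⊆ S ∧ 0 < ν.real C ∧ ν.real C < ε := by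
  have key : ∀ n : ℕ, ∃ C : Set X, MeasurableSet C ∧ C ⊆ S ∧ 0 < ν.real C ∧
      ν.real C ≤ ν.real S * (1 / 2) ^ n := by
    intro n
    induction n with
    | zero => exact ⟨S, hS, subset_rfl, h0, by simp⟩
    | succ n ih =>
      obtain ⟨C, hC, hCS, hC0, hCn⟩ := ih
      obtain ⟨D, hD, hDC, hD0, hDlt⟩ := hat C hC hC0
      have hdiff : ν.real (C \ D) = ν.real C - ν.real D := measureReal_sdiff hDC hD
      have hp : ν.real S * (1 / 2) ^ (n + 1) = (ν.real S * (1 / 2) ^ n) / 2 := by ring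
      rcases le_total (ν.real D) (ν.real C / 2) with h | h
      · exact ⟨D, hD, hDC.trans hCS, hD0, by linarith⟩
      · exact ⟨C \ D, hC.diff hD, Set.sdiff_subset.trans hCS, by linarith, by linarith⟩
  obtain ⟨n, hn⟩ := exists_pow_lt_of_lt_one (div_pos hε h0) (by norm_num : (1 / 2 : ℝ) < 1)
  obtain ⟨C, hC, hCS, hC0, hCn⟩ := key n
  refine ⟨C, hC, hCS, hC0, hCn.trans_lt ?_⟩
  rw [lt_div_iff₀ h0] at hn
  linarith

theorem exists_measure_eq (hat : Atomless ν) {S : Set X} (hS : MeasurableSet S)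
    {t : ℝ} (ht0 : 0 ≤ t) (htS : t ≤ ν.real S) :
    ∃ C : Set X, MeasurableSet C ∧ C ⊆ S ∧ ν.real C = t := by
  let P : Set X → Prop := fun C => MeasurableSet C ∧ C ⊆ S ∧ ν.real C ≤ t
  have step : ∀ C : {C // P C}, ∃ C' : {C // P C}, C.1 ⊆ C'.1 ∧
      ∀ D, P D → C.1 ⊆ D → ν.real C.1 + ν.real D ≤ 2 * ν.real C'.1 := by
    rintro ⟨C, hC⟩
    let T : Set ℝ := {r | ∃ D, P D ∧ C ⊆ D ∧ ν.real D = r}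
    have hTne : T.Nonempty := ⟨_, C, hC, subset_rfl, rfl⟩
    have hTb : BddAbove T := ⟨t, by rintro r ⟨D, hD, -, rfl⟩; exact hD.2.2⟩
    by_cases h : ν.real C < sSup T
    · obtain ⟨r, ⟨D, hD, hCD, rfl⟩, hlt⟩ := exists_lt_of_lt_csSup hTne
        (show (ν.real C + sSup T) / 2 < sSup T by linarith)
      refine ⟨⟨D, hD⟩, hCD, fun D' hD' hCD' => ?_⟩
      have := le_csSup hTb ⟨D', hD', hCD', rfl⟩
      simp only
      linarith
    · refine ⟨⟨C, hC⟩, subset_rfl, fun D' hD' hCD' => ?_⟩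
      have := le_csSup hTb ⟨D', hD', hCD', rfl⟩
      simp only
      linarith
  choose next hnext hmax using step
  let c : ℕ → {C // P C} := fun n => next^[n] ⟨∅, MeasurableSet.empty, Set.empty_subset _, by simpa⟩
  have hc : ∀ n, c (n + 1) = next (c n) := fun n => Function.iterate_succ_apply' _ _ _
  have hmono : Monotone (fun n => (c n).1) :=
    monotone_nat_of_le_succ fun n => by rw [hc]; exact hnext _
  have hlim : Filter.Tendsto (fun n => ν.real (c n).1) Filter.atTop
      (nhds (ν.real (⋃ n, (c n).1))) := by
    have := tendsto_measure_iUnion_atTop (μ := ν) hmono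
    exact (ENNReal.tendsto_toReal (measure_ne_top ν _)).comp this
  set U := ⋃ n, (c n).1 with hU
  have hUm : MeasurableSet U := MeasurableSet.iUnion fun n => (c n).2.1
  have hUS : U ⊆ S := Set.iUnion_subset fun n => (c n).2.2.1
  have hUt : ν.real U ≤ t := le_of_tendsto' hlim fun n => (c n).2.2.2
  have hUmax : ∀ D, P D → U ⊆ D → ν.real D ≤ ν.real U := by
    intro D hD hUD
    have h1 : ν.real U + ν.real D ≤ 2 * ν.real U := by
      refine le_of_tendsto_of_tendsto' (hlim.add_const _)
        ((hlim.comp (Filter.tendsto_add_atTop_nat 1)).const_mul 2) fun n => ?_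
      simp only [Function.comp]
      rw [hc]
      exact hmax _ D hD ((Set.subset_iUnion (fun n => (c n).1) n).trans hUD)
    linarith
  refine ⟨U, hUm, hUS, le_antisymm hUt (not_lt.1 fun hlt => ?_)⟩
  have hd : ν.real (S \ U) = ν.real S - ν.real U := measureReal_sdiff hUS hUm
  obtain ⟨C, hC, hCS, hC0, hCe⟩ := exists_small hat (hS.diff hUm)
    (show 0 < ν.real (S \ U) by linarith) (sub_pos.2 hlt)
  have hu : ν.real (U ∪ C) = ν.real U + ν.real C :=
    measureReal_union (Set.disjoint_of_subset_right hCS Set.disjoint_sdiff_right) hC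
  have := hUmax (U ∪ C) ⟨hUm.union hC, Set.union_subset hUS (hCS.trans Set.sdiff_subset),
    by linarith⟩ Set.subset_union_left
  linarith

theorem exists_halving (hat : Atomless ν) (s : Finset (Set X)) (hs : ∀ E ∈ s, MeasurableSet E) :
    ∀ S, MeasurableSet S → ∃ C : Set X, MeasurableSet C ∧ C ⊆ S ∧ ν.real C = ν.real S / 2 ∧
      ∀ E ∈ s, ν.real (E ∩ C) = ν.real (E ∩ S) / 2 := by
  classical
  induction s using Finset.induction_on with
  | empty =>
    intro S hS
    have := measureReal_nonneg (μ := ν) (s := S)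
    obtain ⟨C, hC, hCS, h⟩ := exists_measure_eq hat hS (t := ν.real S / 2) (by linarith)
      (by linarith)
    exact ⟨C, hC, hCS, h, by simp⟩
  | insert F s _ ih =>
    intro S hS
    have hF : MeasurableSet F := hs F (by simp)
    have ih' := ih fun E hE => hs E (by simp [hE])
    obtain ⟨C₁, hC₁, hs₁, h₁, hh₁⟩ := ih' (S ∩ F) (hS.inter hF)
    obtain ⟨C₂, hC₂, hs₂, h₂, hh₂⟩ := ih' (S \ F) (hS.diff hF)
    have hdisj : Disjoint C₁ C₂ := Set.disjoint_left.2 fun x h h' => (hs₂ h').2 (hs₁ h).2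
    have hSF : ν.real (S ∩ F) + ν.real (S \ F) = ν.real S := measureReal_inter_add_sdiff hF
    refine ⟨C₁ ∪ C₂, hC₁.union hC₂, ?_, ?_, ?_⟩
    · exact Set.union_subset (hs₁.trans Set.inter_subset_left) (hs₂.trans Set.sdiff_subset)
    · rw [measureReal_union hdisj hC₂]; linarith
    · intro E hE
      rcases Finset.mem_insert.1 hE with rfl | hE
      · have e1 : E ∩ (C₁ ∪ C₂) = C₁ := by
          ext x
          have a := @hs₁ x
          have b := @hs₂ x
          simp only [Set.mem_inter_iff, Set.mem_union, Set.mem_sdiff] at *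
          tauto
        rw [e1, h₁, Set.inter_comm]
      · have hEm := hs E (by simp [hE])
        rw [Set.inter_union_distrib_left, measureReal_union
          (hdisj.mono Set.inter_subset_right Set.inter_subset_right) (hEm.inter hC₂),
          hh₁ E hE, hh₂ E hE]
        have : ν.real ((E ∩ S) ∩ F) + ν.real ((E ∩ S) \ F) = ν.real (E ∩ S) :=
          measureReal_inter_add_sdiff hF
        rw [Set.inter_assoc, Set.inter_sdiff_assoc] at this
        linarith

theorem exists_rademacher (hat : Atomless ν) {S : Set X} (hS : MeasurableSet S) :
    ∃ E : ℕ → Set X, (∀ n, MeasurableSet (E n) ∧ E n ⊆ S ∧ ν.real (E n) = ν.real S / 2) ∧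
      ∀ m n, m < n → ν.real (E m \ E n) = ν.real S / 4 := by
  apply exists_seq_of_forall_finset_exists
    (fun E => MeasurableSet E ∧ E ⊆ S ∧ ν.real E = ν.real S / 2)
    (fun E E' => ν.real (E \ E') = ν.real S / 4)
  intro s hs
  obtain ⟨C, hC, hCS, h, hh⟩ := exists_halving hat s (fun E hE => (hs E hE).1) S hS
  refine ⟨C, ⟨hC, hCS, h⟩, fun E hE => ?_⟩
  have h1 := hh E hE
  rw [Set.inter_eq_left.2 (hs E hE).2.1, (hs E hE).2.2] at h1
  have h2 : ν.real (E ∩ C) + ν.real (E \ C) = ν.real E := measureReal_inter_add_sdiff hC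
  rw [(hs E hE).2.2] at h2
  linarith

theorem exists_family (hat : Atomless ν) {S : Set X} (hS : MeasurableSet S) (h0 : 0 < ν.real S) :
    ∃ (D : Set X) (E : ℕ → ℕ → Set X) (C : ℕ → Set X) (b : ℝ), 0 < b ∧ MeasurableSet D ∧
      D ⊆ S ∧
      (∀ k j, MeasurableSet (E k j) ∧ E k j ⊆ D ∧ ν.real (E k j) ≤ b * (1 / 4) ^ k) ∧
      (∀ j, MeasurableSet (C j) ∧ C j ⊆ S \ D ∧ 0 < ν.real (C j) ∧ ν.real (C j) ≤ b * (1 / 4) ^ j) ∧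
      (∀ k j j', j < j' → b * (1 / 4) ^ k / 4 ≤ ν.real (E k j \ E k j')) ∧
      (∀ k k' j j', k < k' → b * (1 / 4) ^ k / 4 ≤ ν.real (E k j \ E k' j')) := by
  obtain ⟨D, hD, hDS, hDm⟩ := exists_measure_eq hat hS (t := ν.real S / 2) (by linarith)
      (by linarith)
  have hd : ν.real (S \ D) = ν.real S - ν.real D := measureReal_sdiff hDS hD
  have hp : ∀ k : ℕ, (1 / 4 : ℝ) ^ k ≤ 1 := fun k => pow_le_one₀ (by norm_num) (by norm_num)
  have hp0 : ∀ k : ℕ, 0 < (1 / 4 : ℝ) ^ k := fun k => by positivity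
  set b := ν.real S / 2 with hb
  have hb0 : 0 < b := by linarith
  have hB : ∀ k : ℕ, ∃ B, MeasurableSet B ∧ B ⊆ D ∧ ν.real B = b * (1 / 4) ^ k := fun k =>
    exists_measure_eq hat hD (by positivity) (by rw [hDm]; nlinarith [hp k])
  have hC : ∀ k : ℕ, ∃ B, MeasurableSet B ∧ B ⊆ S \ D ∧ ν.real B = b * (1 / 4) ^ k := fun k =>
    exists_measure_eq hat (hS.diff hD) (by positivity) (by rw [hd]; nlinarith [hp k])
  choose B hBm hBD hBν using hB
  choose C hCm hCD hCν using hC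
  choose E hE hE' using fun k => exists_rademacher hat (hBm k)
  refine ⟨D, E, C, b, hb0, hD, hDS, fun k j => ⟨(hE k j).1, (hE k j).2.1.trans (hBD k), ?_⟩,
    fun j => ⟨hCm j, hCD j, ?_, (hCν j).le⟩, fun k j j' h => ?_, fun k k' j j' h => ?_⟩
  · rw [(hE k j).2.2, hBν]
    have := mul_pos hb0 (hp0 k)
    linarith
  · rw [hCν]; exact mul_pos hb0 (hp0 j)
  · rw [hE' k j j' h, hBν]
  · have h1 : ν.real (E k j) - ν.real (E k' j') ≤ ν.real (E k j \ E k' j') := by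
      have := measureReal_inter_add_sdiff (μ := ν) (s := E k j) (t := E k' j') (hE k' j').1
      have h3 : ν.real (E k j ∩ E k' j') ≤ ν.real (E k' j') := measureReal_mono Set.inter_subset_right
      linarith
    rw [(hE k j).2.2, (hE k' j').2.2, hBν, hBν] at h1
    have h2 : (1 / 4 : ℝ) ^ k' ≤ (1 / 4) ^ (k + 1) :=
      pow_le_pow_of_le_one (by norm_num) (by norm_num) h
    rw [pow_succ] at h2
    nlinarith [hp0 k]
end OCM
namespace OCM
open Filter Topology

theorem ae_tendsto_of_isGLB {X : Type*} [MeasurableSpace X] {μ : Measure X}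
    (z : ℕ → Lp ℝ ∞ μ) (a : Lp ℝ ∞ μ) (hz : Antitone z) (ha : IsGLB (Set.range z) a) :
    ∀ᵐ x ∂μ, Tendsto (fun n => (z n : X → ℝ) x) atTop (𝓝 ((a : X → ℝ) x)) := by
  have h1 : ∀ᵐ x ∂μ, ∀ n, (z (n + 1) : X → ℝ) x ≤ (z n : X → ℝ) x := by
    rw [ae_all_iff]
    intro n
    exact (Lp.coeFn_le _ _).2 (hz (Nat.le_succ n))
  have h2 : ∀ᵐ x ∂μ, ∀ n, (a : X → ℝ) x ≤ (z n : X → ℝ) x := by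
    rw [ae_all_iff]
    intro n
    exact (Lp.coeFn_le _ _).2 (ha.1 ⟨n, rfl⟩)
  let h : X → ℝ := fun x => ⨅ n, (z n : X → ℝ) x
  have hm : Measurable h := Measurable.iInf fun n => (Lp.stronglyMeasurable (z n)).measurable
  have hbd : ∀ᵐ x ∂μ, BddBelow (Set.range fun n => (z n : X → ℝ) x) := by
    filter_upwards [h2] with x hx
    exact ⟨(a : X → ℝ) x, by rintro _ ⟨n, rfl⟩; exact hx n⟩
  have hle : ∀ᵐ x ∂μ, ∀ n, h x ≤ (z n : X → ℝ) x := by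
    filter_upwards [hbd] with x hx n
    exact ciInf_le hx n
  have hge : ∀ᵐ x ∂μ, (a : X → ℝ) x ≤ h x := by
    filter_upwards [h2] with x hx
    exact le_ciInf hx
  have hmem : MemLp h ∞ μ := by
    refine MemLp.mono' ((Lp.memLp a).abs.add (Lp.memLp (z 0)).abs) hm.aestronglyMeasurable ?_
    filter_upwards [hle, hge] with x hx hx'
    have hx0 := hx 0
    simp only [Pi.add_apply, Pi.abs_apply, Real.norm_eq_abs]
    rw [abs_le]
    constructor
    · linarith [neg_abs_le ((a : X → ℝ) x), abs_nonneg ((z 0 : X → ℝ) x)]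
    · linarith [le_abs_self ((z 0 : X → ℝ) x), abs_nonneg ((a : X → ℝ) x)]
  have hlb : hmem.toLp h ≤ a := by
    apply ha.2
    rintro _ ⟨n, rfl⟩
    rw [← Lp.coeFn_le]
    filter_upwards [hmem.coeFn_toLp, hle] with x hx hx'
    rw [hx]
    exact hx' n
  rw [← Lp.coeFn_le] at hlb
  filter_upwards [h1, hbd, hlb, hmem.coeFn_toLp, hge] with x a1 a2 a3 a4 a5
  rw [a4] at a3
  rw [le_antisymm a5 a3]
  exact tendsto_atTop_ciInf (antitone_nat_of_succ_le a1) a2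

theorem ae_of_O1Converges {X : Type*} [MeasurableSpace X] {μ : Measure X}
    (x : ℕ → Lp ℝ ∞ μ) (a : Lp ℝ ∞ μ) (h : O1Converges x a) :
    (∀ᵐ t ∂μ, Tendsto (fun n => (x n : X → ℝ) t) atTop (𝓝 ((a : X → ℝ) t))) ∧
    ∃ (R : ℝ) (N : ℕ), ∀ n, N ≤ n → ∀ᵐ t ∂μ, (x n : X → ℝ) t ≤ R := by
  obtain ⟨y, z, hy, hz, hya, hza, N, hN⟩ := h
  have hz' := ae_tendsto_of_isGLB z a hz hza
  have hy' := ae_tendsto_of_isGLB (fun n => -y n) (-a) (fun m n hmn => neg_le_neg (hy hmn)) (by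
    rw [← isLUB_neg]
    convert hya using 1
    · ext f
      simp)
  constructor
  · have hx : ∀ᵐ t ∂μ, ∀ n, N ≤ n → (y n : X → ℝ) t ≤ (x n : X → ℝ) t ∧
        (x n : X → ℝ) t ≤ (z n : X → ℝ) t := by
      rw [ae_all_iff]
      intro n
      by_cases hn : N ≤ n
      · filter_upwards [(Lp.coeFn_le _ _).2 (hN n hn).1, (Lp.coeFn_le _ _).2 (hN n hn).2]
          with t h1 h2 _
        exact ⟨h1, h2⟩
      · exact ae_of_all _ fun t h => absurd h hn
    have hneg : ∀ᵐ t ∂μ, ∀ n, (-y n : Lp ℝ ∞ μ) t = - (y n : X → ℝ) t := by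
      rw [ae_all_iff]
      intro n
      filter_upwards [Lp.coeFn_neg (y n)] with t ht
      rw [ht]; rfl
    filter_upwards [hz', hy', hx, hneg, Lp.coeFn_neg a] with t h1 h2 h3 h4 h5
    rw [h5] at h2
    simp only [h4, Pi.neg_apply] at h2
    have h2' := h2.neg
    simp only [neg_neg] at h2'
    refine tendsto_of_tendsto_of_tendsto_of_le_of_le' h2' h1 ?_ ?_
    · filter_upwards [eventually_ge_atTop N] with n hn using (h3 n hn).1
    · filter_upwards [eventually_ge_atTop N] with n hn using (h3 n hn).2
  · have hb := ae_le_eLpNormEssSup (f := (z 0 : X → ℝ)) (μ := μ)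
    have hfin : eLpNormEssSup (z 0 : X → ℝ) μ ≠ ∞ := by
      have := (Lp.memLp (z 0)).2
      rw [eLpNorm_exponent_top] at this
      exact this.ne
    refine ⟨(eLpNormEssSup (z 0 : X → ℝ) μ).toReal, N, fun n hn => ?_⟩
    filter_upwards [hb, (Lp.coeFn_le _ _).2 (hN n hn).2, (Lp.coeFn_le _ _).2 (hz (Nat.zero_le n))]
      with t h1 h2 h3
    have h4 := ENNReal.toReal_mono hfin h1
    rw [toReal_enorm, Real.norm_eq_abs] at h4
    exact (h2.trans h3).trans ((le_abs_self _).trans h4)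

/-- The basic functions. -/
noncomputable def fn {X : Type*} (E : ℕ → ℕ → Set X) (C : ℕ → Set X) (k j : ℕ) : X → ℝ :=
  fun x => (E k j).indicator (fun _ => (1 : ℝ)) x + (C j).indicator (fun _ => (k : ℝ) + 1) x

theorem fn_memLp {X : Type*} [MeasurableSpace X] {μ : Measure X}
    {E : ℕ → ℕ → Set X} {C : ℕ → Set X} (hE : ∀ k j, MeasurableSet (E k j))
    (hC : ∀ j, MeasurableSet (C j)) (k j : ℕ) : MemLp (fn E C k j) ∞ μ := by
  refine memLp_top_of_bound (C := (k : ℝ) + 2) ?_ (ae_of_all _ fun x => ?_)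
  · exact ((measurable_const.indicator (hE k j)).add
      (measurable_const.indicator (hC j))).aestronglyMeasurable
  · have : (0 : ℝ) ≤ k := Nat.cast_nonneg k
    rw [Real.norm_eq_abs, abs_le]
    unfold fn Set.indicator
    split_ifs <;> constructor <;> linarith

theorem abs_integral_le {X : Type*} [MeasurableSpace X] {μ : Measure X}
    {E : ℕ → ℕ → Set X} {C : ℕ → Set X} (hE : ∀ k j, MeasurableSet (E k j))
    (hC : ∀ j, MeasurableSet (C j)) (k j : ℕ) (g : X → ℝ) (hg : Integrable g μ)
    (h1 : ∫ x in E k j, |g x| ∂μ ≤ 1 / 2) (h2 : ∫ x in C j, |g x| ∂μ ≤ 1 / (2 * ((k : ℝ) + 1))) :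
    |∫ x, fn E C k j x * g x ∂μ| ≤ 1 := by
  have hk : (0 : ℝ) < (k : ℝ) + 1 := by positivity
  have e : ∀ x, fn E C k j x * g x =
      (E k j).indicator g x + (C j).indicator (fun x => ((k : ℝ) + 1) * g x) x := by
    intro x
    unfold fn Set.indicator
    split_ifs <;> ring
  simp_rw [e]
  rw [integral_add (hg.indicator (hE k j)) ((hg.const_mul _).indicator (hC j)),
    integral_indicator (hE k j), integral_indicator (hC j), integral_const_mul]
  have a1 := abs_integral_le_integral_abs (f := g) (μ := μ.restrict (E k j))
  have a2 := abs_integral_le_integral_abs (f := g) (μ := μ.restrict (C j))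
  have a3 : ((k : ℝ) + 1) * |∫ x in C j, g x ∂μ| ≤ 1 / 2 := by
    calc ((k : ℝ) + 1) * |∫ x in C j, g x ∂μ| ≤ ((k : ℝ) + 1) * (1 / (2 * ((k : ℝ) + 1))) := by
          gcongr; exact a2.trans h2
      _ = 1 / 2 := by field_simp
  refine (abs_add_le _ _).trans ?_
  rw [abs_mul, abs_of_pos hk]
  linarith

end OCM

open OCM Filter Topology in
/-- Let `(X, Σ, μ)` be a semi-finite measure space and `A` a measurable set of nonzero
measure containing no μ-atoms.  Then there is a set `F ⊆ L^∞(μ)` with `0 ∉ F` which is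
sequentially O₁-closed in the μ-a.e. order, yet for every norm-bounded uniformly integrable
set `K` of integrable functions there is `f ∈ F` with `|∫ f·g dμ| ≤ 1` for all `g ∈ K`.
(Hence the order topology on `L^∞` differs from the Mackey topology `τ(L^∞, L¹)`.) -/
theorem exists_order_closed_set_mackey_adherent {X : Type*} [MeasurableSpace X]
    (μ : Measure X)
    (hsemifinite : ∀ E : Set X, MeasurableSet E → μ E = ∞ →
      ∃ G : Set X, MeasurableSet G ∧ G ⊆ E ∧ 0 < μ G ∧ μ G < ∞)
    (A : Set X) (hA : MeasurableSet A) (hA0 : μ A ≠ 0)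
    (hatomless : ∀ B : Set X, MeasurableSet B → B ⊆ A → 0 < μ B →
      ∃ C : Set X, MeasurableSet C ∧ C ⊆ B ∧ 0 < μ C ∧ μ C < μ B) :
    ∃ F : Set (Lp ℝ ∞ μ),
      (0 : Lp ℝ ∞ μ) ∉ F ∧
      (∀ x : ℕ → Lp ℝ ∞ μ, (∀ n, x n ∈ F) → ∀ a : Lp ℝ ∞ μ, O1Converges x a → a ∈ F) ∧
      (∀ K : Set (X → ℝ), (∀ g ∈ K, Integrable g μ) →
        (∃ C : ℝ, ∀ g ∈ K, ∫ x, |g x| ∂μ ≤ C) →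
        (∀ ε : ℝ, 0 < ε → ∃ δ : ℝ, 0 < δ ∧ ∀ g ∈ K, ∀ S : Set X, MeasurableSet S →
          μ S ≤ ENNReal.ofReal δ → ∫ x in S, |g x| ∂μ ≤ ε) →
        ∃ f ∈ F, ∀ g ∈ K, |∫ x, (f : X → ℝ) x * g x ∂μ| ≤ 1) := by
  obtain ⟨B, hB, hBA, hB0, hBt⟩ : ∃ B, MeasurableSet B ∧ B ⊆ A ∧ 0 < μ B ∧ μ B < ∞ := by
    by_cases h : μ A = ∞
    · exact hsemifinite A hA h
    · exact ⟨A, hA, subset_rfl, pos_iff_ne_zero.2 hA0, lt_top_iff_ne_top.2 h⟩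
  let ν := μ.restrict B
  have : IsFiniteMeasure ν := ⟨by simpa [ν] using hBt⟩
  have hνμ : ∀ S ⊆ B, ν S = μ S := fun S hS => Measure.restrict_eq_self μ hS
  have hat : Atomless ν := by
    intro S hS hS0
    have hS0' : 0 < μ (S ∩ B) := by
      rw [← Measure.restrict_apply hS]
      exact (ENNReal.toReal_pos_iff.1 hS0).1
    obtain ⟨C, hC, hCS, hC0, hClt⟩ := hatomless (S ∩ B) (hS.inter hB)
      (Set.inter_subset_right.trans hBA) hS0'
    have hCB : C ⊆ B := hCS.trans Set.inter_subset_right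
    refine ⟨C, hC, hCS.trans Set.inter_subset_left, ?_, ?_⟩
    · rw [Measure.real, hνμ C hCB]
      exact ENNReal.toReal_pos hC0.ne' ((measure_mono hCB).trans_lt hBt).ne
    · refine ENNReal.toReal_strict_mono (measure_ne_top ν S) ?_
      rw [hνμ C hCB]
      exact hClt.trans_eq (Measure.restrict_apply hS).symm
  obtain ⟨D, E, C, b, hb, hD, hDB, hE, hC, hsep1, hsep2⟩ := exists_family hat hB (by
    rw [Measure.real, hνμ B subset_rfl]
    exact ENNReal.toReal_pos hB0.ne' hBt.ne)
  have hEm := fun k j => (hE k j).1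
  have hCm := fun j => (hC j).1
  let f : ℕ → ℕ → Lp ℝ ∞ μ := fun k j => (fn_memLp (μ := μ) hEm hCm k j).toLp _
  have hf : ∀ k j, (f k j : X → ℝ) =ᵐ[μ] fn E C k j := fun k j => MemLp.coeFn_toLp _
  have hνae : ∀ {p : X → Prop}, (∀ᵐ x ∂μ, p x) → ∀ᵐ x ∂ν, p x := fun h => ae_restrict_of_ae h
  have hfC : ∀ k j, ∀ x ∈ C j, fn E C k j x = (k : ℝ) + 1 := by
    intro k j x hx
    have : x ∉ E k j := fun h => ((hC j).2.1 hx).2 ((hE k j).2.1 h)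
    simp [fn, hx, this]
  -- a property holding a.e. holds somewhere on `C j`
  have hex : ∀ j, ∀ {p : X → Prop}, (∀ᵐ x ∂μ, p x) → ∃ x ∈ C j, p x := by
    intro j p hp
    by_contra! hcon
    have h0 : ν (C j) = 0 := measure_mono_null (fun x hx => hcon x hx) (hνae hp)
    have := (hC j).2.2.1
    rw [Measure.real, h0] at this
    simp at this
  refine ⟨{u | ∃ k j, u = f k j}, ?_, ?_, ?_⟩
  · rintro ⟨k, j, h⟩
    have h1 := hf k j
    rw [← h] at h1
    obtain ⟨x, hx, h2, h3⟩ := hex j (h1.and (Lp.coeFn_zero ℝ ∞ μ))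
    rw [h3, hfC k j x hx] at h2
    have : (0 : ℝ) ≤ k := Nat.cast_nonneg k
    simp at h2
    linarith
  · intro x hx a hxa
    choose k j hkj using hx
    obtain ⟨hlim, R, N, hN⟩ := ae_of_O1Converges x a hxa
    have hk : ∀ n, N ≤ n → k n ≤ ⌊R⌋₊ := by
      intro n hn
      have h1 := hN n hn
      rw [hkj n] at h1
      obtain ⟨t, ht, h2, h3⟩ := hex (j n) ((hf (k n) (j n)).and h1)
      rw [h2, hfC _ _ t ht] at h3
      exact Nat.le_floor (by linarith)
    set M := ⌊R⌋₊ with hM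
    set c : ℝ := b * (1 / 4) ^ M / 4 with hc
    have hc0 : 0 < c := by positivity
    have hck : ∀ k ≤ M, c ≤ b * (1 / 4) ^ k / 4 := by
      intro k hk
      have : (1 / 4 : ℝ) ^ M ≤ (1 / 4) ^ k :=
        pow_le_pow_of_le_one (by norm_num) (by norm_num) hk
      rw [hc]
      gcongr
    -- separation
    have hdiff : ∀ k j k' j', ∀ t ∈ E k j \ E k' j', fn E C k j t = 1 ∧ fn E C k' j' t = 0 := by
      intro k j k' j' t ht
      have hn : ∀ i, t ∉ C i := fun i h => ((hC i).2.1 h).2 ((hE k j).2.1 ht.1)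
      simp [fn, hn, ht.1, ht.2]
    have hTM : TendstoInMeasure ν (fun n => (x n : X → ℝ)) atTop a :=
      tendstoInMeasure_of_tendsto_ae
        (fun n => (Lp.stronglyMeasurable (x n)).aestronglyMeasurable) (hνae hlim)
    have hTM' := (tendstoInMeasure_iff_dist.1 hTM) (1 / 2) (by norm_num)
    have hev : ∀ᶠ n in atTop, ν {t | 1 / 2 ≤ dist ((x n : X → ℝ) t) ((a : X → ℝ) t)} <
        ENNReal.ofReal (c / 2) := hTM'.eventually_lt_const (by simpa using hc0)
    obtain ⟨N', hN'⟩ := eventually_atTop.1 hev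
    have hbad : ∀ m n, max N N' ≤ m → max N N' ≤ n →
        ν.real (E (k m) (j m) \ E (k n) (j n)) < c := by
      intro m n hm hn
      have h1 := hN' m (le_trans (le_max_right _ _) hm)
      have h2 := hN' n (le_trans (le_max_right _ _) hn)
      have hm' : ∀ᵐ t ∂ν, (x m : X → ℝ) t = fn E C (k m) (j m) t := by
        rw [hkj m]; exact hνae (hf _ _)
      have hn' : ∀ᵐ t ∂ν, (x n : X → ℝ) t = fn E C (k n) (j n) t := by
        rw [hkj n]; exact hνae (hf _ _)
      have hsub : (E (k m) (j m) \ E (k n) (j n) : Set X) ≤ᵐ[ν]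
          ({t | 1 / 2 ≤ dist ((x m : X → ℝ) t) ((a : X → ℝ) t)} ∪
            {t | 1 / 2 ≤ dist ((x n : X → ℝ) t) ((a : X → ℝ) t)} : Set X) := by
        filter_upwards [hm', hn'] with t h3 h4 ht
        obtain ⟨h5, h6⟩ := hdiff _ _ _ _ t ht
        rw [h5] at h3
        rw [h6] at h4
        change 1 / 2 ≤ dist ((x m : X → ℝ) t) ((a : X → ℝ) t) ∨
          1 / 2 ≤ dist ((x n : X → ℝ) t) ((a : X → ℝ) t)
        by_contra! hcon
        have := dist_triangle_right ((x m : X → ℝ) t) ((x n : X → ℝ) t) ((a : X → ℝ) t)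
        have h7 : dist ((x m : X → ℝ) t) ((x n : X → ℝ) t) = 1 := by
          rw [h3, h4]; simp
        linarith [hcon.1, hcon.2]
      have h8 := ((measure_mono_ae hsub).trans (measure_union_le _ _)).trans_lt
        (ENNReal.add_lt_add h1 h2)
      rw [← ENNReal.ofReal_add (by positivity) (by positivity), add_halves] at h8
      exact (ENNReal.lt_ofReal_iff_toReal_lt (measure_ne_top _ _)).1 h8
    have hkeq : ∀ n, max N N' ≤ n → x n = x (max N N') := by
      intro n hn
      set m := max N N' with hm
      have hkn := hk n (le_trans (le_max_left _ _) hn)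
      have hkm := hk m (le_max_left _ _)
      have b1 := hbad n m hn le_rfl
      have b2 := hbad m n le_rfl hn
      rcases lt_trichotomy (k n) (k m) with h | h | h
      · linarith [hsep2 _ _ (j n) (j m) h, hck _ hkn]
      · rcases lt_trichotomy (j n) (j m) with h' | h' | h'
        · rw [← h] at b1
          linarith [hsep1 (k n) _ _ h', hck _ hkn]
        · rw [hkj n, hkj m, h, h']
        · rw [← h] at b2
          linarith [hsep1 (k n) _ _ h', hck _ hkn]
      · linarith [hsep2 _ _ (j m) (j n) h, hck _ hkm]
    refine ⟨k (max N N'), j (max N N'), ?_⟩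
    rw [← hkj]
    apply Lp.ext
    filter_upwards [hlim] with t ht
    refine tendsto_nhds_unique ht (tendsto_const_nhds.congr' ?_)
    filter_upwards [eventually_ge_atTop (max N N')] with n hn
    rw [hkeq n hn]
  · intro K hK _ hUI
    have hpow : ∀ δ : ℝ, 0 < δ → ∃ n : ℕ, b * (1 / 4) ^ n ≤ δ := by
      intro δ hδ
      obtain ⟨n, hn⟩ := exists_pow_lt_of_lt_one (div_pos hδ hb) (by norm_num : (1 / 4 : ℝ) < 1)
      rw [lt_div_iff₀ hb] at hn
      exact ⟨n, by linarith⟩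
    have hμ : ∀ S ⊆ B, ∀ δ : ℝ, ν.real S ≤ δ → μ S ≤ ENNReal.ofReal δ := by
      intro S hS δ h
      rw [← hνμ S hS]
      exact (ENNReal.le_ofReal_iff_toReal_le (measure_ne_top ν S)
        (measureReal_nonneg.trans h)).2 h
    obtain ⟨δ, hδ, h1⟩ := hUI (1 / 2) (by norm_num)
    obtain ⟨k, hk⟩ := hpow δ hδ
    obtain ⟨δ', hδ', h2⟩ := hUI (1 / (2 * ((k : ℝ) + 1))) (by positivity)
    obtain ⟨j, hj⟩ := hpow δ' hδ'
    refine ⟨f k j, ⟨k, j, rfl⟩, fun g hg => ?_⟩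
    have e : ∫ x, (f k j : X → ℝ) x * g x ∂μ = ∫ x, fn E C k j x * g x ∂μ := by
      refine integral_congr_ae ?_
      filter_upwards [hf k j] with x hx
      rw [hx]
    rw [e]
    exact abs_integral_le hEm hCm k j g (hK g hg)
      (h1 g hg _ (hEm k j) (hμ _ ((hE k j).2.1.trans hDB) _ ((hE k j).2.2.trans hk)))
      (h2 g hg _ (hCm j) (hμ _ ((hC j).2.1.trans Set.sdiff_subset) _ ((hC j).2.2.2.trans hj)))
end

section
/- Let H be a complex Hilbert space and M a von Neumann algebra acting on H. Assume there exists a net (e_λ)_{λ∈Λ} of finite-rank orthogonal projections belonging to M (each e_λ satisfies e_λ* = e_λ = e_λ² and has finite-dimensional range), which is monotone increasing in the Loewner order and satisfies e_λ v → v in norm for every v ∈ H. Let (x_γ)_{γ∈Γ} be a net of selfadjoint elements of M with ‖x_γ‖ ≤ 1 for all γ, and let x be a selfadjoint element of M such that x_γ v → x v in norm for every v ∈ H (convergence in the strong operator topology). Then (x_γ) O₂-converges to x in the partially ordered set of selfadjoint elements of M equipped with the Loewner order. -/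
open Filter

section Helpers

variable {H : Type*} [NormedAddCommGroup H] [InnerProductSpace ℂ H] [CompleteSpace H]

lemma aux_le_iff {a b : H →L[ℂ] H} (ha : IsSelfAdjoint a) (hb : IsSelfAdjoint b) :
    a ≤ b ↔ ∀ v, (inner ℂ (a v) v).re ≤ (inner ℂ (b v) v).re := by
  rw [ContinuousLinearMap.le_def, ContinuousLinearMap.isPositive_def']
  constructor
  · intro h v
    have := h.2 v
    simp only [ContinuousLinearMap.reApplyInnerSelf, ContinuousLinearMap.sub_apply,
      inner_sub_left, map_sub, RCLike.re_to_complex] at this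
    linarith
  · intro h
    refine ⟨hb.sub ha, fun v => ?_⟩
    have := h v
    simp only [ContinuousLinearMap.reApplyInnerSelf, ContinuousLinearMap.sub_apply,
      inner_sub_left, map_sub, RCLike.re_to_complex]
    linarith

/-- The dominating operator `3 - t e`. -/
noncomputable def auxW (t : ℝ) (e : H →L[ℂ] H) : H →L[ℂ] H := (3 : ℂ) • 1 - (t : ℂ) • e

lemma auxW_mem (M : VonNeumannAlgebra H) (t : ℝ) {e : H →L[ℂ] H} (he : e ∈ M) :
    auxW t e ∈ M := by
  have hs : ∀ (c : ℂ) (a : H →L[ℂ] H), a ∈ M → c • a ∈ M := fun c a ha =>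
    M.toStarSubalgebra.smul_mem ha c
  exact sub_mem (hs _ _ (one_mem M)) (hs _ _ he)

lemma auxW_sa (t : ℝ) {e : H →L[ℂ] H} (he : IsSelfAdjoint e) :
    IsSelfAdjoint (auxW t e) := by
  unfold auxW
  refine IsSelfAdjoint.sub (IsSelfAdjoint.smul ?_ (IsSelfAdjoint.one _)) (IsSelfAdjoint.smul ?_ he)
  · simp [isSelfAdjoint_iff]
  · simp [isSelfAdjoint_iff]

lemma auxW_inner (t : ℝ) (e : H →L[ℂ] H) (v : H) :
    (inner ℂ (auxW t e v) v).re = 3 * ‖v‖ ^ 2 - t * (inner ℂ (e v) v).re := by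
  have h : (inner ℂ v v).re = ‖v‖ ^ 2 := by
    rw [inner_self_eq_norm_sq_to_K]; norm_cast
  simp [auxW, inner_sub_left, inner_smul_left, -inner_self_eq_norm_sq_to_K, h]
  ring

lemma aux_proj {e : H →L[ℂ] H} (he : IsSelfAdjoint e) (hi : e.comp e = e) (v : H) :
    (inner ℂ (e v) v).re = ‖e v‖ ^ 2 ∧ ‖v‖ ^ 2 = ‖e v‖ ^ 2 + ‖v - e v‖ ^ 2 := by
  have hee : e (e v) = e v := by
    have := congrArg (fun f : H →L[ℂ] H => f v) hi
    simpa using this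
  have h1 : inner ℂ (e v) v = inner ℂ (e v) (e v) := by
    have := (ContinuousLinearMap.isSelfAdjoint_iff_isSymmetric.mp he) (e v) v
    simp only [ContinuousLinearMap.coe_coe, hee] at this
    exact this
  have h2 : (inner ℂ (e v) v).re = ‖e v‖ ^ 2 := by
    rw [h1, inner_self_eq_norm_sq_to_K]; norm_cast
  refine ⟨h2, ?_⟩
  have h3 := norm_add_sq (𝕜 := ℂ) (e v) (v - e v)
  rw [inner_sub_right, h1, sub_self] at h3
  simpa using h3

lemma aux_bound {e y : H →L[ℂ] H} (he : IsSelfAdjoint e) (hi : e.comp e = e)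
    (hy : IsSelfAdjoint y) (hy2 : ∀ v, ‖y v‖ ≤ 2 * ‖v‖) {t : ℝ} (ht : 2 ≤ t) (ht3 : t < 3)
    (hd : ∀ v, ‖y (e v)‖ ≤ (3 - t) / 2 * ‖e v‖) : y ≤ auxW t e := by
  rw [aux_le_iff hy (auxW_sa t he)]
  intro v
  obtain ⟨h1, h2⟩ := aux_proj he hi v
  rw [auxW_inner, h1, h2]
  have hdv := hd v
  set p := e v with hp
  set q := v - p with hq
  have hv : v = p + q := by simp [hq]
  have hs : inner ℂ (y q) p = inner ℂ q (y p) :=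
    (ContinuousLinearMap.isSelfAdjoint_iff_isSymmetric.mp hy) q p
  have h3 : (inner ℂ (y v) v).re = (inner ℂ (y p) p).re + (inner ℂ (y p) q).re
      + (inner ℂ q (y p)).re + (inner ℂ (y q) q).re := by
    conv_lhs => rw [hv]
    rw [map_add, inner_add_left, inner_add_right, inner_add_right, hs]
    simp; ring
  rw [h3]
  have a1 : (inner ℂ (y p) p).re ≤ ‖y p‖ * ‖p‖ := re_inner_le_norm (𝕜 := ℂ) _ _
  have a2 : (inner ℂ (y p) q).re ≤ ‖y p‖ * ‖q‖ := re_inner_le_norm (𝕜 := ℂ) _ _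
  have a3 : (inner ℂ q (y p)).re ≤ ‖q‖ * ‖y p‖ := re_inner_le_norm (𝕜 := ℂ) _ _
  have a4 : (inner ℂ (y q) q).re ≤ ‖y q‖ * ‖q‖ := re_inner_le_norm (𝕜 := ℂ) _ _
  have b1 := mul_le_mul_of_nonneg_right hdv (norm_nonneg p)
  have b2 := mul_le_mul_of_nonneg_right hdv (norm_nonneg q)
  have b3 := mul_le_mul_of_nonneg_right (hy2 q) (norm_nonneg q)
  have b4 : 0 ≤ (3 - t) / 2 * (‖p‖ - ‖q‖) ^ 2 := by
    have : 0 ≤ (3 - t) / 2 := by linarith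
    positivity
  have b5 : (3 - t) / 2 * ‖q‖ ^ 2 ≤ 1 * ‖q‖ ^ 2 := by
    gcongr; linarith
  nlinarith

lemma aux_eventually {Γ : Type*} [Preorder Γ] [IsDirected Γ (· ≤ ·)] [Nonempty Γ]
    {e : H →L[ℂ] H} (hfr : FiniteDimensional ℂ (LinearMap.range e.toLinearMap))
    (y : Γ → H →L[ℂ] H) (hy : ∀ v, Tendsto (fun γ => y γ v) atTop (nhds 0))
    {d : ℝ} (hd : 0 < d) :
    ∀ᶠ γ in atTop, ∀ v, ‖y γ (e v)‖ ≤ d * ‖e v‖ := by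
  let b := stdOrthonormalBasis ℂ (LinearMap.range e.toLinearMap)
  have h : Tendsto (fun γ => ∑ i, ‖y γ (b i : H)‖) atTop (nhds 0) := by
    have := tendsto_finsetSum (Finset.univ) (fun i _ => (hy (b i : H)).norm)
    simpa using this
  filter_upwards [h.eventually (gt_mem_nhds hd)] with γ hγ v
  let p : LinearMap.range e.toLinearMap := ⟨e v, v, rfl⟩
  have hp : e v = ∑ i, inner ℂ (b i) p • (b i : H) := by
    have := congrArg (Subtype.val) (b.sum_repr' p)
    simpa [p] using this.symm
  have hpn : ‖p‖ = ‖e v‖ := rfl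
  calc ‖y γ (e v)‖ = ‖∑ i, inner ℂ (b i) p • y γ (b i : H)‖ := by
        rw [hp, map_sum]; simp only [map_smul]
    _ ≤ ∑ i, ‖inner ℂ (b i) p • y γ (b i : H)‖ := norm_sum_le _ _
    _ ≤ ∑ i, ‖y γ (b i : H)‖ * ‖e v‖ := by
        refine Finset.sum_le_sum fun i _ => ?_
        rw [norm_smul, mul_comm]
        gcongr
        have := norm_inner_le_norm (𝕜 := ℂ) (b i) p
        rwa [b.norm_eq_one, one_mul, hpn] at this
    _ = (∑ i, ‖y γ (b i : H)‖) * ‖e v‖ := by rw [Finset.sum_mul]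
    _ ≤ d * ‖e v‖ := by gcongr

lemma auxW_anti {e f : H →L[ℂ] H} (he : IsSelfAdjoint e) (hf : IsSelfAdjoint f)
    (hi : e.comp e = e) (hef : e ≤ f) {s t : ℝ} (hst : s ≤ t) (ht : 0 ≤ t) :
    auxW t f ≤ auxW s e := by
  rw [aux_le_iff (auxW_sa t hf) (auxW_sa s he)]
  intro v
  rw [auxW_inner, auxW_inner]
  have h1 := (aux_le_iff he hf).mp hef v
  have h2 := (aux_proj he hi v).1
  have h3 : 0 ≤ (inner ℂ (e v) v).re := by rw [h2]; positivity
  have := mul_le_mul_of_nonneg_left h1 ht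
  have := mul_le_mul_of_nonneg_right hst h3
  linarith

lemma aux_inf {Λ : Type*} [Preorder Λ] [IsDirected Λ (· ≤ ·)] [Nonempty Λ]
    (e : Λ → H →L[ℂ] H) (he_sa : ∀ l, IsSelfAdjoint (e l))
    (he_one : ∀ v : H, Tendsto (fun l => e l v) atTop (nhds v))
    {z : H →L[ℂ] H} (hz : IsSelfAdjoint z)
    (h : ∀ l, ∀ t ∈ Set.Ico (2 : ℝ) 3, z ≤ auxW t (e l)) : z ≤ 0 := by
  rw [aux_le_iff hz (IsSelfAdjoint.zero _)]
  intro v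
  have h1 : ∀ l, ∀ t ∈ Set.Ico (2 : ℝ) 3,
      (inner ℂ (z v) v).re ≤ 3 * ‖v‖ ^ 2 - t * (inner ℂ (e l v) v).re := by
    intro l t ht
    rw [← auxW_inner]
    exact (aux_le_iff hz (auxW_sa t (he_sa l))).mp (h l t ht) v
  have hv : (inner ℂ v v).re = ‖v‖ ^ 2 := by
    rw [inner_self_eq_norm_sq_to_K]; norm_cast
  have h2 : ∀ t ∈ Set.Ico (2 : ℝ) 3, (inner ℂ (z v) v).re ≤ 3 * ‖v‖ ^ 2 - t * ‖v‖ ^ 2 := by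
    intro t ht
    have hl : Tendsto (fun l => 3 * ‖v‖ ^ 2 - t * (inner ℂ (e l v) v).re) atTop
        (nhds (3 * ‖v‖ ^ 2 - t * (inner ℂ v v).re)) := by
      refine tendsto_const_nhds.sub (tendsto_const_nhds.mul ?_)
      exact (Complex.continuous_re.tendsto _).comp ((he_one v).inner tendsto_const_nhds)
    rw [hv] at hl
    exact ge_of_tendsto' hl fun l => h1 l t ht
  have h3 : (inner ℂ (z v) v).re ≤ 0 := by
    by_contra! hc
    set r := (inner ℂ (z v) v).re
    have hb := h2 2 ⟨le_refl _, by norm_num⟩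
    have hn : 0 < ‖v‖ ^ 2 := by linarith
    have hr : 0 < r / (2 * ‖v‖ ^ 2) := by positivity
    have hr2 : r / (2 * ‖v‖ ^ 2) * ‖v‖ ^ 2 = r / 2 := by
      have hne : ‖v‖ ^ 2 ≠ 0 := hn.ne'
      generalize ‖v‖ ^ 2 = w at hne
      field_simp
    have hr1 : r / (2 * ‖v‖ ^ 2) ≤ 1 := by
      rw [div_le_one (by positivity)]; linarith
    have := h2 (3 - r / (2 * ‖v‖ ^ 2)) ⟨by linarith, by linarith⟩
    nlinarith
  simpa using h3

end Helpers

/-- Let `M` be a von Neumann algebra on a complex Hilbert space `H` admitting a monotone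
increasing net of finite-rank projections converging strongly to the identity.  If a net of
selfadjoint elements of `M` of norm at most one converges in the strong operator topology to
a selfadjoint `x₀ ∈ M`, then it O₂-converges to `x₀` in the poset of selfadjoint elements
of `M` with the Loewner order. -/
theorem o2Converges_of_sot_tendsto {H : Type*} [NormedAddCommGroup H]
    [InnerProductSpace ℂ H] [CompleteSpace H] (M : VonNeumannAlgebra H)
    {Λ : Type*} [Preorder Λ] [IsDirected Λ (· ≤ ·)] [Nonempty Λ]
    (e : Λ → H →L[ℂ] H) (he_mem : ∀ l, e l ∈ M)
    (he_sa : ∀ l, IsSelfAdjoint (e l)) (he_idem : ∀ l, (e l).comp (e l) = e l)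
    (he_fr : ∀ l, FiniteDimensional ℂ (LinearMap.range (e l).toLinearMap))
    (he_mono : Monotone e)
    (he_one : ∀ v : H, Tendsto (fun l => e l v) atTop (nhds v))
    {Γ : Type*} [Preorder Γ] [IsDirected Γ (· ≤ ·)] [Nonempty Γ]
    (x : Γ → H →L[ℂ] H) (hx_mem : ∀ γ, x γ ∈ M) (hx_sa : ∀ γ, IsSelfAdjoint (x γ))
    (hx_norm : ∀ γ, ‖x γ‖ ≤ 1)
    (x₀ : H →L[ℂ] H) (hx₀_mem : x₀ ∈ M) (hx₀_sa : IsSelfAdjoint x₀)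
    (hsot : ∀ v : H, Tendsto (fun γ => x γ v) atTop (nhds (x₀ v))) :
    O2Converges
      (fun γ => (⟨x γ, hx_mem γ, hx_sa γ⟩ : {a : H →L[ℂ] H // a ∈ M ∧ IsSelfAdjoint a}))
      (⟨x₀, hx₀_mem, hx₀_sa⟩ : {a : H →L[ℂ] H // a ∈ M ∧ IsSelfAdjoint a}) := by
  have hx₀2 : ∀ v, ‖x₀ v‖ ≤ ‖v‖ := fun v =>
    le_of_tendsto' (hsot v).norm fun γ => by
      simpa using (x γ).le_of_opNorm_le (hx_norm γ) v
  have hx2 : ∀ γ v, ‖x γ v‖ ≤ ‖v‖ := fun γ v => by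
    simpa using (x γ).le_of_opNorm_le (hx_norm γ) v
  have hy : ∀ v, Tendsto (fun γ => (x γ - x₀) v) atTop (nhds 0) := fun v => by
    simpa using (hsot v).sub_const (x₀ v)
  have hev : ∀ l, ∀ t ∈ Set.Ico (2 : ℝ) 3, ∀ᶠ γ in atTop,
      x γ - x₀ ≤ auxW t (e l) ∧ x₀ - x γ ≤ auxW t (e l) := by
    intro l t ht
    have hd : 0 < (3 - t) / 2 := by linarith [ht.2]
    filter_upwards [aux_eventually (he_fr l) (fun γ => x γ - x₀) hy hd] with γ hγ
    have hb : ∀ v, ‖(x γ - x₀) v‖ ≤ 2 * ‖v‖ := fun v => by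
      have := norm_sub_le (x γ v) (x₀ v)
      have h1 := hx2 γ v
      have h2 := hx₀2 v
      rw [ContinuousLinearMap.sub_apply]
      linarith
    refine ⟨aux_bound (he_sa l) (he_idem l) ((hx_sa γ).sub hx₀_sa) hb ht.1 ht.2 hγ,
      aux_bound (he_sa l) (he_idem l) (hx₀_sa.sub (hx_sa γ)) (fun v => ?_) ht.1 ht.2
        (fun v => ?_)⟩
    · rw [← neg_sub, ContinuousLinearMap.neg_apply, norm_neg]
      exact hb v
    · rw [← neg_sub, ContinuousLinearMap.neg_apply, norm_neg]
      exact hγ v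
  have hdir : ∀ l l' : Λ, ∀ t ∈ Set.Ico (2 : ℝ) 3, ∀ t' ∈ Set.Ico (2 : ℝ) 3,
      ∃ k, ∃ s ∈ Set.Ico (2 : ℝ) 3, auxW s (e k) ≤ auxW t (e l) ∧
        auxW s (e k) ≤ auxW t' (e l') := by
    intro l l' t ht t' ht'
    obtain ⟨k, hk, hk'⟩ := exists_ge_ge l l'
    refine ⟨k, max t t', ⟨le_max_of_le_left ht.1, max_lt ht.2 ht'.2⟩, ?_, ?_⟩
    · exact auxW_anti (he_sa _) (he_sa _) (he_idem _) (he_mono hk) (le_max_left _ _)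
        (le_max_of_le_left (by linarith [ht.1]))
    · exact auxW_anti (he_sa _) (he_sa _) (he_idem _) (he_mono hk') (le_max_right _ _)
        (le_max_of_le_left (by linarith [ht.1]))
  have hpos : ∀ l, ∀ t ∈ Set.Ico (2 : ℝ) 3, 0 ≤ auxW t (e l) := by
    intro l t ht
    refine aux_bound (he_sa l) (he_idem l) (IsSelfAdjoint.zero _) (fun v => ?_) ht.1 ht.2
      (fun v => ?_)
    · simp
    · have : 0 ≤ (3 - t) / 2 := by linarith [ht.2]
      simp only [ContinuousLinearMap.zero_apply, norm_zero]
      positivity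
  obtain ⟨l₀⟩ := ‹Nonempty Λ›
  have h22 : (2 : ℝ) ∈ Set.Ico (2 : ℝ) 3 := ⟨le_refl _, by norm_num⟩
  have : Nonempty Λ := ⟨l₀⟩
  refine ⟨{a | ∃ l, ∃ t ∈ Set.Ico (2 : ℝ) 3, a.1 = x₀ - auxW t (e l)},
    {a | ∃ l, ∃ t ∈ Set.Ico (2 : ℝ) 3, a.1 = x₀ + auxW t (e l)},
    ⟨⟨x₀ - auxW 2 (e l₀), sub_mem hx₀_mem (auxW_mem M _ (he_mem _)),
      hx₀_sa.sub (auxW_sa _ (he_sa _))⟩, l₀, 2, h22, rfl⟩, ?_,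
    ⟨⟨x₀ + auxW 2 (e l₀), add_mem hx₀_mem (auxW_mem M _ (he_mem _)),
      hx₀_sa.add (auxW_sa _ (he_sa _))⟩, l₀, 2, h22, rfl⟩, ?_, ⟨?_, ?_⟩, ⟨?_, ?_⟩, ?_⟩
  · rintro ⟨a, ha⟩ ⟨l, t, ht, rfl⟩ ⟨b, hb⟩ ⟨l', t', ht', rfl⟩
    obtain ⟨k, s, hs, h1, h2⟩ := hdir l l' t ht t' ht'
    exact ⟨⟨x₀ - auxW s (e k), sub_mem hx₀_mem (auxW_mem M _ (he_mem _)),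
      hx₀_sa.sub (auxW_sa _ (he_sa _))⟩, ⟨k, s, hs, rfl⟩,
      sub_le_sub_left h1 x₀, sub_le_sub_left h2 x₀⟩
  · rintro ⟨a, ha⟩ ⟨l, t, ht, rfl⟩ ⟨b, hb⟩ ⟨l', t', ht', rfl⟩
    obtain ⟨k, s, hs, h1, h2⟩ := hdir l l' t ht t' ht'
    exact ⟨⟨x₀ + auxW s (e k), add_mem hx₀_mem (auxW_mem M _ (he_mem _)),
      hx₀_sa.add (auxW_sa _ (he_sa _))⟩, ⟨k, s, hs, rfl⟩,
      add_le_add_right h1 x₀, add_le_add_right h2 x₀⟩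
  · rintro ⟨a, ha⟩ ⟨l, t, ht, rfl⟩
    exact sub_le_self x₀ (hpos l t ht)
  · rintro ⟨z, hzM, hz⟩ hub
    have : x₀ - z ≤ 0 := by
      refine aux_inf e he_sa he_one (hx₀_sa.sub hz) fun l t ht => ?_
      have : x₀ - auxW t (e l) ≤ z :=
        @hub ⟨x₀ - auxW t (e l), sub_mem hx₀_mem (auxW_mem M _ (he_mem _)),
          hx₀_sa.sub (auxW_sa _ (he_sa _))⟩ ⟨l, t, ht, rfl⟩
      exact sub_le_comm.mp this
    have h' := sub_nonpos.mp this
    exact h'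
  · rintro ⟨a, ha⟩ ⟨l, t, ht, rfl⟩
    exact le_add_of_nonneg_right (hpos l t ht)
  · rintro ⟨z, hzM, hz⟩ hlb
    have : z - x₀ ≤ 0 := by
      refine aux_inf e he_sa he_one (hz.sub hx₀_sa) fun l t ht => ?_
      have : z ≤ x₀ + auxW t (e l) :=
        @hlb ⟨x₀ + auxW t (e l), add_mem hx₀_mem (auxW_mem M _ (he_mem _)),
          hx₀_sa.add (auxW_sa _ (he_sa _))⟩ ⟨l, t, ht, rfl⟩
      exact sub_le_iff_le_add'.mpr this
    have h' := sub_nonpos.mp this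
    exact h'
  · rintro ⟨a, ha⟩ ⟨l, t, ht, rfl⟩ ⟨b, hb⟩ ⟨l', t', ht', rfl⟩
    obtain ⟨γ₀, hγ₀⟩ := eventually_atTop.mp ((hev l t ht).and (hev l' t' ht'))
    refine ⟨γ₀, fun γ hγ => ⟨?_, ?_⟩⟩
    · exact sub_le_comm.mp (hγ₀ γ hγ).1.2
    · exact sub_le_iff_le_add'.mp (hγ₀ γ hγ).2.1
end
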